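/- arXiv:hep-th/9605076 — 2 statements merged into one kernel-verified Lean document; each statement's English description precedes it below -/
import Mathlib

section
/- Theorem (T_n) (main order-reduction lemma): Let L^{μν}_A (μ,ν = 1,…,n; A = 1,…,N) be first-order functions, symmetric in μ,ν, satisfying (int1) and (int2). Then there exist first-order functions V^μ (μ = 1,…,n) such that L^{μν}_A = ∂^μ_A V^ν + ∂^ν_A V^μ for all μ, ν, A. -/
/-!
Theorem (T_n): the main order-reduction lemma.

A first-order function is a smooth real-valued function on
`J n N = ℝ^n × ℝ^N × ℝ^{N×n}`, with points `(xᵘ, ψᴬ, ψᴬ_μ)`.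
`pd A μ f` is the partial derivative `∂ᵘ_A f = ∂f/∂ψᴬ_μ`.
-/

/-- The first-order jet-type space `J = ℝ^n × ℝ^N × ℝ^{N×n}`. -/
abbrev J (n N : ℕ) : Type :=
  (Fin n → ℝ) × (Fin N → ℝ) × (Fin N → Fin n → ℝ)

/-- `∂ᵘ_A f`: the partial derivative with respect to the variable `ψᴬ_μ`. -/
noncomputable def pd {n N : ℕ} (A : Fin N) (μ : Fin n) (f : J n N → ℝ) :
    J n N → ℝ :=
  fun p => fderiv ℝ f p (0, 0, Pi.single A (Pi.single μ (1 : ℝ)))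

open scoped ContDiff

section ParametricIntegral

variable {H : Type} [NormedAddCommGroup H] [NormedSpace ℝ H]

theorem hasFDerivAt_snd_slice {E : Type*} [NormedAddCommGroup E] [NormedSpace ℝ E]
    {F : ℝ × H → E} (hF : Differentiable ℝ F) (t : ℝ) (x : H) :
    HasFDerivAt (fun x => F (t, x)) ((fderiv ℝ F (t, x)).comp (.inr ℝ ℝ H)) x :=
  (hF (t, x)).hasFDerivAt.comp x (hasFDerivAt_prodMk_right t x)

variable [FiniteDimensional ℝ H]

theorem hasFDerivAt_intervalIntegral_of_contDiff {E : Type*} [NormedAddCommGroup E]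
    [NormedSpace ℝ E] {F : ℝ × H → E} (hF : ContDiff ℝ 1 F) (x₀ : H) :
    HasFDerivAt (fun x => ∫ t in (0 : ℝ)..1, F (t, x))
      (∫ t in (0 : ℝ)..1, (fderiv ℝ F (t, x₀)).comp (.inr ℝ ℝ H)) x₀ := by
  have hd : Continuous fun q : ℝ × H => (fderiv ℝ F q).comp (.inr ℝ ℝ H) :=
    (hF.continuous_fderiv one_ne_zero).clm_comp continuous_const
  obtain ⟨C, hC⟩ := ((isCompact_Icc (a := (0 : ℝ)) (b := 1)).prod
    (isCompact_closedBall x₀ 1)).exists_bound_of_continuousOn hd.continuousOn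
  refine intervalIntegral.hasFDerivAt_integral_of_dominated_of_fderiv_le
    (F := fun x t => F (t, x)) (F' := fun x t => (fderiv ℝ F (t, x)).comp (.inr ℝ ℝ H))
    (bound := fun _ => C)
    (Metric.closedBall_mem_nhds x₀ one_pos) (.of_forall fun x => ?_) ?_ ?_ ?_ (by simp) ?_
  · exact (hF.continuous.comp (by fun_prop : Continuous fun t : ℝ => (t, x))).aestronglyMeasurable
  · exact (hF.continuous.comp
      (by fun_prop : Continuous fun t : ℝ => (t, x₀))).intervalIntegrable _ _
  · exact (hd.comp (by fun_prop : Continuous fun t : ℝ => (t, x₀))).aestronglyMeasurable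
  · refine .of_forall fun t ht x hx => hC (t, x) ⟨?_, hx⟩
    rw [Set.uIoc_of_le zero_le_one] at ht
    exact ⟨ht.1.le, ht.2⟩
  · exact .of_forall fun t _ x _ => hasFDerivAt_snd_slice (hF.differentiable one_ne_zero) t x

theorem contDiff_nat_intervalIntegral (m : ℕ) {E : Type} [NormedAddCommGroup E]
    [NormedSpace ℝ E] {F : ℝ × H → E} (hF : ContDiff ℝ ∞ F) :
    ContDiff ℝ m (fun x => ∫ t in (0 : ℝ)..1, F (t, x)) := by
  induction m generalizing E with
  | zero =>
    refine contDiff_zero.2 (continuous_iff_continuousAt.2 fun x => ?_)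
    exact (hasFDerivAt_intervalIntegral_of_contDiff
      (hF.of_le (by exact_mod_cast le_top)) x).continuousAt
  | succ m ih =>
    have h1 : ContDiff ℝ 1 F := hF.of_le (by exact_mod_cast le_top)
    rw [Nat.cast_add, Nat.cast_one, contDiff_succ_iff_fderiv]
    refine ⟨fun x => (hasFDerivAt_intervalIntegral_of_contDiff h1 x).differentiableAt,
      by simp, ?_⟩
    rw [funext fun x => (hasFDerivAt_intervalIntegral_of_contDiff h1 x).fderiv]
    exact ih ((hF.fderiv_right (by exact_mod_cast le_top)).clm_comp contDiff_const)

theorem contDiff_intervalIntegral {E : Type} [NormedAddCommGroup E]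
    [NormedSpace ℝ E] {F : ℝ × H → E} (hF : ContDiff ℝ ∞ F) :
    ContDiff ℝ ∞ (fun x => ∫ t in (0 : ℝ)..1, F (t, x)) :=
  contDiff_infty.2 fun m => contDiff_nat_intervalIntegral m hF

end ParametricIntegral

section OrderReduction

variable {n N : ℕ}

theorem ContDiff.pd {f : J n N → ℝ} (hf : ContDiff ℝ ∞ f) (A : Fin N) (μ : Fin n) :
    ContDiff ℝ ∞ (pd A μ f) :=
  (hf.fderiv_right (by exact_mod_cast le_top)).clm_apply contDiff_const

theorem pd_eq_of_hasFDerivAt {f : J n N → ℝ} {p : J n N} {f' : J n N →L[ℝ] ℝ}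
    (h : HasFDerivAt f f' p) (A : Fin N) (μ : Fin n) :
    pd A μ f p = f' (0, 0, Pi.single A (Pi.single μ (1 : ℝ))) := by
  rw [pd, h.fderiv]

theorem ContDiff.hasFDerivAt_infty {f : J n N → ℝ} (hf : ContDiff ℝ ∞ f) (p : J n N) :
    HasFDerivAt f (fderiv ℝ f p) p :=
  (hf.differentiable (by simp) p).hasFDerivAt

theorem pd_zero (A : Fin N) (μ : Fin n) : pd A μ (0 : J n N → ℝ) = 0 := by
  funext p
  exact (pd_eq_of_hasFDerivAt (hasFDerivAt_const (0 : ℝ) p) A μ).trans rfl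

theorem pd_add {f g : J n N → ℝ} (hf : ContDiff ℝ ∞ f) (hg : ContDiff ℝ ∞ g)
    (A : Fin N) (μ : Fin n) : pd A μ (f + g) = pd A μ f + pd A μ g := by
  funext p
  exact pd_eq_of_hasFDerivAt ((hf.hasFDerivAt_infty p).add (hg.hasFDerivAt_infty p)) A μ

theorem pd_sub {f g : J n N → ℝ} (hf : ContDiff ℝ ∞ f) (hg : ContDiff ℝ ∞ g)
    (A : Fin N) (μ : Fin n) : pd A μ (f - g) = pd A μ f - pd A μ g := by
  funext p
  exact pd_eq_of_hasFDerivAt ((hf.hasFDerivAt_infty p).sub (hg.hasFDerivAt_infty p)) A μ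

theorem pd_mul {f g : J n N → ℝ} (hf : ContDiff ℝ ∞ f) (hg : ContDiff ℝ ∞ g)
    (A : Fin N) (μ : Fin n) : pd A μ (f * g) = pd A μ f * g + f * pd A μ g := by
  funext p
  rw [pd_eq_of_hasFDerivAt ((hf.hasFDerivAt_infty p).mul (hg.hasFDerivAt_infty p)) A μ]
  simp [pd]
  ring

theorem pd_const_smul {f : J n N → ℝ} (hf : ContDiff ℝ ∞ f) (c : ℝ)
    (A : Fin N) (μ : Fin n) : pd A μ (c • f) = c • pd A μ f := by
  funext p
  exact pd_eq_of_hasFDerivAt ((hf.hasFDerivAt_infty p).const_smul c) A μ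

theorem contDiff_finset_sum {ι : Type*} (u : Finset ι) {f : ι → J n N → ℝ}
    (hf : ∀ i, ContDiff ℝ ∞ (f i)) : ContDiff ℝ ∞ (∑ i ∈ u, f i) := by
  rw [Finset.sum_fn]
  exact ContDiff.sum fun i _ => hf i

theorem pd_sum {ι : Type*} (u : Finset ι) {f : ι → J n N → ℝ} (hf : ∀ i, ContDiff ℝ ∞ (f i))
    (A : Fin N) (μ : Fin n) : pd A μ (∑ i ∈ u, f i) = ∑ i ∈ u, pd A μ (f i) := by
  funext p
  rw [pd_eq_of_hasFDerivAt (HasFDerivAt.sum fun i _ => (hf i).hasFDerivAt_infty p) A μ]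
  simp [pd]

theorem pd_comm {f : J n N → ℝ} (hf : ContDiff ℝ ∞ f) (A B : Fin N) (μ ν : Fin n) :
    pd A μ (pd B ν f) = pd B ν (pd A μ f) := by
  have key (p v w : J n N) :
      fderiv ℝ (fun q => fderiv ℝ f q w) p v = fderiv ℝ (fderiv ℝ f) p v w := by
    have hd : DifferentiableAt ℝ (fderiv ℝ f) p :=
      (hf.fderiv_right (m := ∞) (by exact_mod_cast le_top)).differentiable (by simp) p
    simp [fderiv_clm_apply hd (differentiableAt_const w)]
  funext p
  change fderiv ℝ (fun q => fderiv ℝ f q _) p _ = fderiv ℝ (fun q => fderiv ℝ f q _) p _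
  rw [key, key]
  exact hf.contDiffAt.isSymmSndFDerivAt
    (by simpa using WithTop.coe_le_coe.2 (le_top : (2 : ℕ∞) ≤ ⊤)) _ _

/-- The coordinate function `ψᴬ_μ`. -/
def coord (A : Fin N) (μ : Fin n) : J n N → ℝ := fun p => p.2.2 A μ

theorem contDiff_coord (A : Fin N) (μ : Fin n) : ContDiff ℝ ∞ (coord A μ) := by
  unfold coord
  fun_prop

theorem pd_coord (A B : Fin N) (μ ν : Fin n) :
    pd A μ (coord B ν) = fun _ => if B = A ∧ ν = μ then 1 else 0 := by
  funext p
  let l : J n N →L[ℝ] ℝ := (ContinuousLinearMap.proj (R := ℝ) (φ := fun _ : Fin n => ℝ) ν).comp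
    ((ContinuousLinearMap.proj (R := ℝ) (φ := fun _ : Fin N => Fin n → ℝ) B).comp
      ((ContinuousLinearMap.snd ℝ _ _).comp (ContinuousLinearMap.snd ℝ _ _)))
  rw [pd_eq_of_hasFDerivAt (f := coord B ν) (l.hasFDerivAt (x := p)) A μ]
  by_cases h : B = A
  · subst h
    simp [l, Pi.single_apply]
  · simp [l, h]

/-- The map multiplying each `ψᴬ_μ` by `a μ + t * b μ`. -/
def scale (a b : Fin n → ℝ) (t : ℝ) (p : J n N) : J n N :=
  (p.1, p.2.1, fun A μ => (a μ + t * b μ) * p.2.2 A μ)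

theorem contDiff_scale (a b : Fin n → ℝ) :
    ContDiff ℝ ∞ fun q : ℝ × J n N => scale a b q.1 q.2 := by
  unfold scale
  fun_prop

theorem contDiff_scale_left (a b : Fin n → ℝ) (p : J n N) :
    ContDiff ℝ ∞ fun t : ℝ => scale a b t p :=
  (contDiff_scale a b).comp (contDiff_id.prodMk contDiff_const)

theorem contDiff_scale_right (a b : Fin n → ℝ) (t : ℝ) :
    ContDiff ℝ ∞ fun p : J n N => scale a b t p :=
  (contDiff_scale a b).comp (contDiff_const.prodMk contDiff_id)

theorem scale_eq_self {a b : Fin n → ℝ} {t : ℝ} (h : ∀ μ, a μ + t * b μ = 1) (p : J n N) :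
    scale a b t p = p := by
  simp [scale, h]

theorem pd_comp_scale {f : J n N → ℝ} (hf : ContDiff ℝ ∞ f) (a b : Fin n → ℝ) (t : ℝ)
    (A : Fin N) (μ : Fin n) :
    pd A μ (fun p => f (scale a b t p)) = fun p => (a μ + t * b μ) * pd A μ f (scale a b t p) := by
  funext p
  let l : J n N →L[ℝ] J n N := LinearMap.toContinuousLinearMap
    { toFun := scale a b t
      map_add' := fun p q => by
        refine Prod.ext rfl (Prod.ext rfl ?_)
        funext A μ
        simp [scale, mul_add]
      map_smul' := fun c p => by
        refine Prod.ext rfl (Prod.ext rfl ?_)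
        funext A μ
        simp [scale]
        ring }
  have hl : HasFDerivAt (fun p => f (scale a b t p))
      ((fderiv ℝ f (scale a b t p)).comp l) p :=
    (hf.hasFDerivAt_infty (scale a b t p)).comp p (l.hasFDerivAt (x := p))
  rw [pd_eq_of_hasFDerivAt hl]
  have : l (0, 0, Pi.single A (Pi.single μ (1 : ℝ))) =
      (a μ + t * b μ) • (0, 0, Pi.single A (Pi.single μ (1 : ℝ))) := by
    refine Prod.ext (by simp [l, scale]) (Prod.ext (by simp [l, scale]) ?_)
    funext B ν
    by_cases hB : B = A
    · subst hB
      by_cases hν : ν = μ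
      · subst hν
        simp [l, scale]
      · simp [l, scale, hν]
    · simp [l, scale, hB]
  rw [ContinuousLinearMap.comp_apply, this, map_smul]
  rfl

/-- The contraction of a family `g` with the velocity of `t ↦ scale a b t p`. -/
def radial (a b : Fin n → ℝ) (g : Fin N → Fin n → J n N → ℝ) (t : ℝ) (p : J n N) : ℝ :=
  ∑ A, ∑ μ, b μ * p.2.2 A μ * g A μ (scale a b t p)

theorem hasDerivAt_comp_scale {f : J n N → ℝ} (hf : ContDiff ℝ ∞ f) (a b : Fin n → ℝ)
    (t : ℝ) (p : J n N) :
    HasDerivAt (fun t => f (scale a b t p)) (radial a b (fun A μ => pd A μ f) t p) t := by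
  have h : HasDerivAt (fun t => scale a b t p)
      ((0, 0, fun A μ => b μ * p.2.2 A μ) : J n N) t := by
    refine (hasDerivAt_const t _).prodMk ((hasDerivAt_const t _).prodMk ?_)
    refine hasDerivAt_pi.2 fun A => hasDerivAt_pi.2 fun μ => ?_
    simpa using (((hasDerivAt_id t).mul_const (b μ)).const_add (a μ)).mul_const (p.2.2 A μ)
  have hv : ((0, 0, fun A μ => b μ * p.2.2 A μ) : J n N) =
      ∑ A, ∑ μ, (b μ * p.2.2 A μ) • (0, 0, Pi.single A (Pi.single μ (1 : ℝ))) := by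
    refine Prod.ext (by simp [Prod.fst_sum]) (Prod.ext (by simp [Prod.fst_sum, Prod.snd_sum]) ?_)
    funext B ν
    simp [Prod.snd_sum, Finset.sum_apply, Pi.single_apply, apply_ite, ite_apply]
  have hr : radial a b (fun A μ => pd A μ f) t p =
      fderiv ℝ f (scale a b t p) (0, 0, fun A μ => b μ * p.2.2 A μ) := by
    rw [hv]
    simp only [radial, pd, map_sum, map_smul, smul_eq_mul]
  rw [hr]
  exact (hf.hasFDerivAt_infty (scale a b t p)).comp_hasDerivAt t h

theorem contDiff_radial {g : Fin N → Fin n → J n N → ℝ} (hg : ∀ A μ, ContDiff ℝ ∞ (g A μ))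
    (a b : Fin n → ℝ) : ContDiff ℝ ∞ fun q : ℝ × J n N => radial a b g q.1 q.2 := by
  unfold radial
  refine ContDiff.sum fun A _ => ContDiff.sum fun μ _ => ?_
  exact ContDiff.mul (by fun_prop) ((hg A μ).comp (contDiff_scale a b))

theorem pd_radial {g : Fin N → Fin n → J n N → ℝ} (hg : ∀ A μ, ContDiff ℝ ∞ (g A μ))
    (a b : Fin n → ℝ) (t : ℝ) (B : Fin N) (ν : Fin n) :
    pd B ν (radial a b g t) = fun p => b ν * g B ν (scale a b t p) +
      (a ν + t * b ν) * radial a b (fun A μ => pd B ν (g A μ)) t p := by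
  have hs (A μ) : ContDiff ℝ ∞ fun p => g A μ (scale a b t p) :=
    (hg A μ).comp (contDiff_scale_right a b t)
  have h : radial a b g t =
      ∑ A, ∑ μ, b μ • (coord A μ * fun p => g A μ (scale a b t p)) := by
    funext p
    simp [radial, coord, Finset.sum_apply, mul_assoc]
  have hc (A μ) : ContDiff ℝ ∞ (coord A μ * fun p => g A μ (scale a b t p)) :=
    (contDiff_coord A μ).mul (hs A μ)
  have hc' (A μ) : ContDiff ℝ ∞ (b μ • (coord A μ * fun p => g A μ (scale a b t p))) :=
    contDiff_const.smul (hc A μ)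
  rw [h, pd_sum _ fun A => contDiff_finset_sum _ (hc' A)]
  simp_rw [pd_sum _ (hc' _), pd_const_smul (hc _ _), pd_mul (contDiff_coord _ _) (hs _ _),
    pd_coord, pd_comp_scale (hg _ _)]
  funext p
  simp only [Finset.sum_apply, Pi.smul_apply, Pi.add_apply, Pi.mul_apply, smul_eq_mul, radial,
    mul_add, Finset.sum_add_distrib, Finset.mul_sum, ite_and]
  congr 1
  · simp
  · refine Finset.sum_congr rfl fun A _ => Finset.sum_congr rfl fun μ _ => ?_
    simp only [coord]
    ring

theorem pd_intervalIntegral {F : ℝ × J n N → ℝ} (hF : ContDiff ℝ ∞ F) (A : Fin N) (μ : Fin n)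
    (p : J n N) :
    pd A μ (fun p => ∫ t in (0 : ℝ)..1, F (t, p)) p =
      ∫ t in (0 : ℝ)..1, pd A μ (fun p => F (t, p)) p := by
  have h1 : ContDiff ℝ 1 F := hF.of_le (by exact_mod_cast le_top)
  rw [pd_eq_of_hasFDerivAt (hasFDerivAt_intervalIntegral_of_contDiff h1 p),
    ContinuousLinearMap.intervalIntegral_apply]
  · refine intervalIntegral.integral_congr fun t _ => ?_
    exact (pd_eq_of_hasFDerivAt (hasFDerivAt_snd_slice
      (hF.differentiable (by simp)) t p) A μ).symm
  · refine Continuous.intervalIntegrable ?_ _ _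
    exact ((h1.continuous_fderiv one_ne_zero).comp
      (by fun_prop : Continuous fun t : ℝ => (t, p))).clm_comp continuous_const

theorem radial_congr {a b : Fin n → ℝ} {g h : Fin N → Fin n → J n N → ℝ}
    (H : ∀ A μ, b μ ≠ 0 → g A μ = h A μ) : radial a b g = radial a b h := by
  funext t p
  refine Finset.sum_congr rfl fun A _ => Finset.sum_congr rfl fun μ _ => ?_
  by_cases hb : b μ = 0
  · simp [hb]
  · rw [H A μ hb]

theorem radial_add (a b : Fin n → ℝ) (g h : Fin N → Fin n → J n N → ℝ) (t : ℝ) (p : J n N) :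
    radial a b (g + h) t p = radial a b g t p + radial a b h t p := by
  simp [radial, mul_add, Finset.sum_add_distrib]

/-- If `f` does not depend on the scaled variables, scaling them does not change it. -/
theorem comp_scale_eq {f : J n N → ℝ} (hf : ContDiff ℝ ∞ f) {a b : Fin n → ℝ}
    (h : ∀ A μ, b μ ≠ 0 → pd A μ f = 0) (t t' : ℝ) (p : J n N) :
    f (scale a b t p) = f (scale a b t' p) := by
  refine is_const_of_deriv_eq_zero (f := fun t => f (scale a b t p))
    (fun t => (hasDerivAt_comp_scale hf a b t p).differentiableAt) (fun t => ?_) t t'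
  rw [(hasDerivAt_comp_scale hf a b t p).deriv, radial_congr (h := fun _ _ => 0) h]
  simp [radial]

/-- The radial homotopy operator in the variables `ψᴬ_μ` with `b μ ≠ 0`. -/
noncomputable def homotopy (a b : Fin n → ℝ) (g : Fin N → Fin n → J n N → ℝ) : J n N → ℝ :=
  fun p => ∫ t in (0 : ℝ)..1, radial a b g t p

section Homotopy

variable {a b : Fin n → ℝ} {g : Fin N → Fin n → J n N → ℝ}

theorem contDiff_homotopy (hg : ∀ A μ, ContDiff ℝ ∞ (g A μ)) :
    ContDiff ℝ ∞ (homotopy a b g) :=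
  contDiff_intervalIntegral (contDiff_radial hg a b)

theorem pd_homotopy (hg : ∀ A μ, ContDiff ℝ ∞ (g A μ)) (B : Fin N) (ν : Fin n) :
    pd B ν (homotopy a b g) = fun p => ∫ t in (0 : ℝ)..1, (b ν * g B ν (scale a b t p) +
      (a ν + t * b ν) * radial a b (fun A μ => pd B ν (g A μ)) t p) := by
  funext p
  refine (pd_intervalIntegral (contDiff_radial hg a b) B ν p).trans ?_
  refine intervalIntegral.integral_congr fun t _ => ?_
  exact congrFun (pd_radial hg a b t B ν) p

theorem pd_homotopy_of_fixed (hg : ∀ A μ, ContDiff ℝ ∞ (g A μ)) (B : Fin N) {ν : Fin n}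
    (ha : a ν = 1) (hb : b ν = 0) :
    pd B ν (homotopy a b g) = homotopy a b fun A μ => pd B ν (g A μ) := by
  rw [pd_homotopy hg]
  simp only [ha, hb, zero_mul, mul_zero, add_zero, zero_add, one_mul]
  rfl

theorem pd_homotopy_of_killed (hg : ∀ A μ, ContDiff ℝ ∞ (g A μ)) (B : Fin N) {ν : Fin n}
    (ha : a ν = 0) (hb : b ν = 0) : pd B ν (homotopy a b g) = 0 := by
  rw [pd_homotopy hg]
  simp only [ha, hb]
  simp [Pi.zero_def]

theorem homotopy_add {h : Fin N → Fin n → J n N → ℝ} (hg : ∀ A μ, ContDiff ℝ ∞ (g A μ))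
    (hh : ∀ A μ, ContDiff ℝ ∞ (h A μ)) :
    homotopy a b g + homotopy a b h = homotopy a b (g + h) := by
  have hi {g : Fin N → Fin n → J n N → ℝ} (hg : ∀ A μ, ContDiff ℝ ∞ (g A μ)) (p : J n N) :
      IntervalIntegrable (fun t => radial a b g t p) MeasureTheory.volume 0 1 :=
    ((contDiff_radial hg a b).continuous.comp
      (by fun_prop : Continuous fun t : ℝ => (t, p))).intervalIntegrable _ _
  funext p
  simp only [homotopy, Pi.add_apply, radial_add]
  exact (intervalIntegral.integral_add (hi hg p) (hi hh p)).symm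

/-- Poincaré lemma in the variables `ψᴬ_μ` with `b μ ≠ 0`. -/
theorem pd_homotopy_of_closed (hg : ∀ A μ, ContDiff ℝ ∞ (g A μ)) (hab : ∀ μ, a μ + b μ = 1)
    {B : Fin N} {ν : Fin n} (hb : b ν = 1)
    (hc : ∀ A μ, b μ ≠ 0 → pd B ν (g A μ) = pd A μ (g B ν)) :
    pd B ν (homotopy a b g) = g B ν := by
  have ha : a ν = 0 := by linarith [hab ν]
  funext p
  rw [pd_homotopy hg, radial_congr (h := fun A μ => pd A μ (g B ν)) hc]
  simp only [ha, hb, one_mul, mul_one, zero_add]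
  have hd (t : ℝ) := (hasDerivAt_id t).mul (hasDerivAt_comp_scale (hg B ν) a b t p)
  simp only [id, one_mul] at hd
  rw [intervalIntegral.integral_eq_sub_of_hasDerivAt (fun t _ => hd t)]
  · simp [scale_eq_self (a := a) (b := b) (t := 1) (by simpa using hab)]
  · refine Continuous.intervalIntegrable ?_ _ _
    exact ((hg B ν).continuous.comp (contDiff_scale_left a b p).continuous).add
      (continuous_id.mul ((contDiff_radial (fun A μ => (hg B ν).pd A μ) a b).continuous.comp
        (by fun_prop : Continuous fun t : ℝ => (t, p))))

theorem homotopy_of_const (hg : ∀ A μ, ContDiff ℝ ∞ (g A μ)) (hab : ∀ μ, a μ + b μ = 1)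
    (hc : ∀ A B μ ν, b μ ≠ 0 → b ν ≠ 0 → pd B ν (g A μ) = 0) :
    homotopy a b g = ∑ A, ∑ μ, b μ • (coord A μ * g A μ) := by
  funext p
  have h (t : ℝ) : radial a b g t p = ∑ A, ∑ μ, b μ * p.2.2 A μ * g A μ p := by
    refine Finset.sum_congr rfl fun A _ => Finset.sum_congr rfl fun μ _ => ?_
    by_cases hb : b μ = 0
    · simp [hb]
    · rw [comp_scale_eq (hg A μ) (fun B ν hν => hc A B μ ν hb hν) t 1 p,
        scale_eq_self (by simpa using hab)]
  simp [homotopy, h, coord, mul_assoc]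

theorem pd_pd_homotopy (hg : ∀ A μ, ContDiff ℝ ∞ (g A μ)) (B C : Fin N) {μ ν : Fin n}
    (haμ : a μ = 0) (hbμ : b μ = 1) (haν : a ν = 0) (hbν : b ν = 1) (p : J n N) :
    pd B μ (pd C ν (homotopy a b g)) p = ∫ t in (0 : ℝ)..1,
      (t * (pd B μ (g C ν) (scale a b t p) + pd C ν (g B μ) (scale a b t p)) +
        t ^ 2 * radial a b (fun A ρ => pd B μ (pd C ν (g A ρ))) t p) := by
  have hg' (A ρ) : ContDiff ℝ ∞ (pd C ν (g A ρ)) := (hg A ρ).pd C ν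
  rw [pd_homotopy hg]
  simp only [haν, hbν, one_mul, mul_one, zero_add]
  rw [pd_intervalIntegral (F := fun q => g C ν (scale a b q.1 q.2) +
    q.1 * radial a b (fun A ρ => pd C ν (g A ρ)) q.1 q.2)]
  · refine intervalIntegral.integral_congr fun t _ => ?_
    have h1 : ContDiff ℝ ∞ fun p => g C ν (scale a b t p) :=
      (hg C ν).comp (contDiff_scale_right a b t)
    have h2 : ContDiff ℝ ∞ (radial a b (fun A ρ => pd C ν (g A ρ)) t) :=
      (contDiff_radial hg' a b).comp (contDiff_const.prodMk contDiff_id)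
    change pd B μ ((fun p => g C ν (scale a b t p)) +
      t • radial a b (fun A ρ => pd C ν (g A ρ)) t) p = _
    have h3 : ContDiff ℝ ∞ (t • radial a b (fun A ρ => pd C ν (g A ρ)) t) :=
      contDiff_const.smul h2
    rw [pd_add h1 h3, pd_const_smul h2, pd_comp_scale (hg C ν),
      pd_radial hg']
    simp only [Pi.add_apply, Pi.smul_apply, smul_eq_mul, haμ, hbμ]
    ring
  · exact ((hg C ν).comp (contDiff_scale a b)).add
      (contDiff_fst.mul (contDiff_radial hg' a b))

/-- The symmetrized Hessian of a homotopy potential, when the symmetrized derivatives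
`∂ᵘ_B g_A^ν + ∂^ν_B g_A^μ` satisfy the compatibility conditions. -/
theorem symmetrized_hessian_homotopy (hg : ∀ A μ, ContDiff ℝ ∞ (g A μ)) (A B : Fin N)
    {μ ν : Fin n} (haμ : a μ = 0) (hbμ : b μ = 1) (haν : a ν = 0) (hbν : b ν = 1)
    (hsymm : pd B μ (g A ν) + pd B ν (g A μ) = pd A μ (g B ν) + pd A ν (g B μ))
    (hcompat : ∀ C ρ, b ρ ≠ 0 → pd B μ (pd A ν (g C ρ)) + pd B ν (pd A μ (g C ρ)) =
      pd C ρ (pd B μ (g A ν) + pd B ν (g A μ))) (p : J n N) :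
    pd B μ (pd A ν (homotopy a b g)) p + pd B ν (pd A μ (homotopy a b g)) p =
      (pd B μ (g A ν) + pd B ν (g A μ)) (scale a b 1 p) := by
  set S := pd B μ (g A ν) + pd B ν (g A μ) with hS
  have hSs : ContDiff ℝ ∞ S := ((hg A ν).pd B μ).add ((hg A μ).pd B ν)
  have hcs (f : J n N → ℝ) (hf : ContDiff ℝ ∞ f) : Continuous fun t => f (scale a b t p) :=
    hf.continuous.comp (contDiff_scale_left a b p).continuous
  have hcr {h : Fin N → Fin n → J n N → ℝ} (hh : ∀ A μ, ContDiff ℝ ∞ (h A μ)) :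
      Continuous fun t => radial a b h t p :=
    (contDiff_radial hh a b).continuous.comp (by fun_prop : Continuous fun t : ℝ => (t, p))
  have hi (C D : Fin N) (κ ρ : Fin n) : IntervalIntegrable (fun t =>
      (t * (pd C κ (g D ρ) (scale a b t p) + pd D ρ (g C κ) (scale a b t p)) +
        t ^ 2 * radial a b (fun A σ => pd C κ (pd D ρ (g A σ))) t p))
      MeasureTheory.volume 0 1 :=
    Continuous.intervalIntegrable ((continuous_id.mul ((hcs _ ((hg D ρ).pd C κ)).add
      (hcs _ ((hg C κ).pd D ρ)))).add ((continuous_pow 2).mul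
        (hcr fun E σ => ((hg E σ).pd D ρ).pd C κ))) _ _
  rw [pd_pd_homotopy hg B A haμ hbμ haν hbν, pd_pd_homotopy hg B A haν hbν haμ hbμ,
    ← intervalIntegral.integral_add (hi _ _ _ _) (hi _ _ _ _)]
  have hd (t : ℝ) : HasDerivAt (fun t => t ^ 2 * S (scale a b t p))
      (2 * t * S (scale a b t p) + t ^ 2 * radial a b (fun C ρ => pd C ρ S) t p) t := by
    have h := (hasDerivAt_pow 2 t).mul (hasDerivAt_comp_scale hSs a b t p)
    norm_num at h
    exact h
  have hftc := intervalIntegral.integral_eq_sub_of_hasDerivAt (a := 0) (b := 1)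
    (fun t _ => hd t) (Continuous.intervalIntegrable (((continuous_const.mul continuous_id).mul
      (hcs S hSs)).add ((continuous_pow 2).mul (hcr fun C ρ => hSs.pd C ρ))) _ _)
  have hend : S (scale a b 1 p) = 1 ^ 2 * S (scale a b 1 p) - 0 ^ 2 * S (scale a b 0 p) := by
    ring
  rw [hend, ← hftc]
  refine intervalIntegral.integral_congr fun t _ => ?_
  have hr := congrFun (congrFun (radial_congr (a := a) (b := b)
    (g := (fun C ρ => pd B μ (pd A ν (g C ρ))) + fun C ρ => pd B ν (pd A μ (g C ρ)))
    hcompat) t) p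
  rw [radial_add] at hr
  have h1 := congrFun hS (scale a b t p)
  have h2 := congrFun (hS.trans hsymm) (scale a b t p)
  simp only [Pi.add_apply] at h1 h2
  simp only [← hr]
  linear_combination (-t) * h1 - t * h2

end Homotopy

/-- The operator `V ↦ ∂ᵘ_A V^ν + ∂^ν_A Vᵘ`. -/
noncomputable def symGrad (V : Fin n → J n N → ℝ) (μ ν : Fin n) (A : Fin N) : J n N → ℝ :=
  pd A μ (V ν) + pd A ν (V μ)

theorem contDiff_symGrad {V : Fin n → J n N → ℝ} (hV : ∀ μ, ContDiff ℝ ∞ (V μ))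
    (μ ν : Fin n) (A : Fin N) : ContDiff ℝ ∞ (symGrad V μ ν A) :=
  ((hV ν).pd A μ).add ((hV μ).pd A ν)

theorem symGrad_add {V W : Fin n → J n N → ℝ} (hV : ∀ μ, ContDiff ℝ ∞ (V μ))
    (hW : ∀ μ, ContDiff ℝ ∞ (W μ)) : symGrad (V + W) = symGrad V + symGrad W := by
  funext μ ν A
  simp only [symGrad, Pi.add_apply, pd_add (hV _) (hW _)]
  abel

theorem symGrad_comm (V : Fin n → J n N → ℝ) (μ ν : Fin n) (A : Fin N) :
    symGrad V μ ν A = symGrad V ν μ A :=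
  add_comm _ _

/-- Smooth symmetric families satisfying the two integrability conditions. -/
structure IsIntegrable (L : Fin n → Fin n → Fin N → J n N → ℝ) : Prop where
  smooth : ∀ μ ν A, ContDiff ℝ ∞ (L μ ν A)
  symm : ∀ μ ν A, L μ ν A = L ν μ A
  int1 : ∀ μ ν ρ A B,
    pd B ρ (L μ ν A) + pd B μ (L ρ ν A) + pd B ν (L μ ρ A) =
      pd A ρ (L μ ν B) + pd A μ (L ρ ν B) + pd A ν (L μ ρ B)
  int2 : ∀ μ ν ρ σ A B C,
    pd B μ (pd C ρ (L σ ν A) + pd C σ (L ρ ν A)) + pd B ν (pd C ρ (L σ μ A) + pd C σ (L ρ μ A)) =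
      pd A μ (pd B ν (L σ ρ C)) + pd A ν (pd B μ (L σ ρ C)) +
        (pd A ρ (pd C σ (L μ ν B)) + pd A σ (pd C ρ (L μ ν B)))

theorem isIntegrable_symGrad {V : Fin n → J n N → ℝ} (hV : ∀ μ, ContDiff ℝ ∞ (V μ)) :
    IsIntegrable (N := N) (symGrad V) where
  smooth := contDiff_symGrad hV
  symm := symGrad_comm V
  int1 μ ν ρ A B := by
    simp only [symGrad, pd_add ((hV _).pd _ _) ((hV _).pd _ _)]
    rw [pd_comm (hV ν) B A ρ μ, pd_comm (hV μ) B A ρ ν, pd_comm (hV ν) B A μ ρ,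
      pd_comm (hV ρ) B A μ ν, pd_comm (hV ρ) B A ν μ, pd_comm (hV μ) B A ν ρ]
    abel
  int2 μ ν ρ σ A B C := by
    have h2 (A B μ ν κ) : ContDiff ℝ ∞ (pd A μ (pd B ν (V κ))) := ((hV κ).pd B ν).pd A μ
    have h3 (A B C D μ ν ρ τ κ κ') :
        ContDiff ℝ ∞ (pd A μ (pd B ν (V κ)) + pd C ρ (pd D τ (V κ'))) :=
      (h2 A B μ ν κ).add (h2 C D ρ τ κ')
    have hc (A B C : Fin N) (μ ν ρ κ : Fin n) :
        pd A μ (pd B ν (pd C ρ (V κ))) = pd B ν (pd A μ (pd C ρ (V κ))) :=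
      pd_comm ((hV κ).pd C ρ) A B μ ν
    have hc' (A B C : Fin N) (μ ν ρ κ : Fin n) :
        pd A μ (pd B ν (pd C ρ (V κ))) = pd A μ (pd C ρ (pd B ν (V κ))) := by
      rw [pd_comm (hV κ) B C ν ρ]
    have hr (A B C : Fin N) (μ ν ρ κ : Fin n) :
        pd B μ (pd C ν (pd A ρ (V κ))) = pd A ρ (pd B μ (pd C ν (V κ))) := by
      rw [hc' B C A, hc B A C]
    simp only [symGrad, pd_add ((hV _).pd _ _) ((hV _).pd _ _), pd_add (h2 _ _ _ _ _) (h2 _ _ _ _ _),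
      pd_add (h3 _ _ _ _ _ _ _ _ _ _) (h3 _ _ _ _ _ _ _ _ _ _)]
    simp only [hr A B C, hc' A C B]
    abel

theorem IsIntegrable.sub {L M : Fin n → Fin n → Fin N → J n N → ℝ} (hL : IsIntegrable L)
    (hM : IsIntegrable M) : IsIntegrable (L - M) where
  smooth μ ν A := (hL.smooth μ ν A).sub (hM.smooth μ ν A)
  symm μ ν A := congrArg₂ (· - ·) (hL.symm μ ν A) (hM.symm μ ν A)
  int1 μ ν ρ A B := by
    have h := congrArg₂ (· - ·) (hL.int1 μ ν ρ A B) (hM.int1 μ ν ρ A B)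
    simp only [Pi.sub_apply, pd_sub (hL.smooth _ _ _) (hM.smooth _ _ _)]
    linear_combination h
  int2 μ ν ρ σ A B C := by
    have h := congrArg₂ (· - ·) (hL.int2 μ ν ρ σ A B C) (hM.int2 μ ν ρ σ A B C)
    simp only [pd_add ((hL.smooth _ _ _).pd _ _) ((hL.smooth _ _ _).pd _ _),
      pd_add ((hM.smooth _ _ _).pd _ _) ((hM.smooth _ _ _).pd _ _)] at h
    have hd (A μ ν ρ B) : ContDiff ℝ ∞ (pd A μ (L ν ρ B) - pd A μ (M ν ρ B)) :=
      ((hL.smooth ν ρ B).pd A μ).sub ((hM.smooth ν ρ B).pd A μ)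
    simp only [Pi.sub_apply, pd_sub (hL.smooth _ _ _) (hM.smooth _ _ _),
      pd_add (hd _ _ _ _ _) (hd _ _ _ _ _),
      pd_sub ((hL.smooth _ _ _).pd _ _) ((hM.smooth _ _ _).pd _ _)]
    linear_combination h

theorem exists_symGrad_diag {L : Fin n → Fin n → Fin N → J n N → ℝ} (hL : IsIntegrable L)
    (k : Fin n) : ∃ V : Fin n → J n N → ℝ, (∀ μ, ContDiff ℝ ∞ (V μ)) ∧ (∀ μ, μ ≠ k → V μ = 0) ∧
      ∀ A, L k k A = symGrad V k k A := by
  classical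
  let g : Fin N → Fin n → J n N → ℝ := fun A _ => (1 / 2 : ℝ) • L k k A
  have hg (A μ) : ContDiff ℝ ∞ (g A μ) := contDiff_const.smul (hL.smooth k k A)
  let b : Fin n → ℝ := Pi.single k 1
  have hb {μ : Fin n} (h : b μ ≠ 0) : μ = k := by
    by_contra hne
    exact h (by simp [b, hne])
  refine ⟨Pi.single k (homotopy (1 - b) b g), fun μ => ?_, fun μ hμ => Pi.single_eq_of_ne hμ _,
    fun A => ?_⟩
  · by_cases h : μ = k
    · subst h
      simpa using contDiff_homotopy hg
    · rw [Pi.single_eq_of_ne h]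
      exact contDiff_const
  · have h : pd A k (homotopy (1 - b) b g) = g A k := by
      refine pd_homotopy_of_closed hg (by simp) (by simp [b]) fun B μ hμ => ?_
      obtain rfl := hb hμ
      simp only [g, pd_const_smul (hL.smooth _ _ _)]
      have := hL.int1 μ μ μ A B
      congr 1
      funext p
      have := congrFun this p
      simp only [Pi.add_apply] at this
      linarith
    rw [symGrad, Pi.single_eq_same, h]
    funext p
    simp [g]
    ring

theorem exists_symGrad_offDiag {L : Fin n → Fin n → Fin N → J n N → ℝ} (hL : IsIntegrable L)
    {s : Finset (Fin n)} {k : Fin n} (hk : k ∉ s) (hs : ∀ i ∈ s, ∀ j ∈ s, ∀ A, L i j A = 0)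
    (hkk : ∀ A, L k k A = 0) :
    ∃ V : Fin n → J n N → ℝ, (∀ μ, ContDiff ℝ ∞ (V μ)) ∧
      ∀ i ∈ insert k s, ∀ j ∈ insert k s, ∀ A, L i j A = symGrad V i j A := by
  classical
  let M : Fin N → Fin n → J n N → ℝ := fun A μ => L μ k A
  have hM (A μ) : ContDiff ℝ ∞ (M A μ) := hL.smooth μ k A
  let b : Fin n → ℝ := Pi.single k 1
  have hb {μ : Fin n} (h : b μ ≠ 0) : μ = k := by
    by_contra hne
    exact h (by simp [b, hne])
  have hbk : b k = 1 := by simp [b]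
  have hab (μ : Fin n) : (1 - b) μ + b μ = 1 := by simp
  let a' : Fin n → ℝ := fun μ => if μ ∈ insert k s then 0 else 1
  let b' : Fin n → ℝ := fun μ => if μ ∈ s then 1 else 0
  have hb' {μ : Fin n} (h : b' μ ≠ 0) : μ ∈ s := by
    by_contra hne
    exact h (by simp [b', hne])
  have hne {i : Fin n} (hi : i ∈ s) : i ≠ k := fun h => hk (h ▸ hi)
  let v := homotopy a' b' M
  have hv : ContDiff ℝ ∞ v := contDiff_homotopy hM
  have hvk (A : Fin N) : pd A k v = 0 :=
    pd_homotopy_of_killed hM A (by simp [a']) (by simp [b', hk])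
  let S : Fin N → Fin N → Fin n → Fin n → J n N → ℝ := fun A B i j =>
    pd B i (M A j) + pd B j (M A i)
  have hS (A B i j) : ContDiff ℝ ∞ (S A B i j) := ((hM A j).pd B i).add ((hM A i).pd B j)
  have hS_symm {i j : Fin n} (hi : i ∈ s) (hj : j ∈ s) (A B : Fin N) :
      S A B i j = S B A i j := by
    have h := hL.int1 i j k A B
    rw [hs i hi j hj, hs i hi j hj, pd_zero, pd_zero, zero_add, zero_add, hL.symm k j,
      hL.symm k j] at h
    exact h
  have hS_indep {i j : Fin n} (hi : i ∈ s) (hj : j ∈ s) (A B C : Fin N) :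
      pd C k (S A B i j) = 0 := by
    have h := hL.int2 i j k k A B C
    simp only [hs i hi j hj, hkk, pd_zero, add_zero, hL.symm k] at h
    simp only [pd_add ((hM _ _).pd _ _) ((hM _ _).pd _ _), S]
    rw [pd_add ((hM A j).pd C k) ((hM A j).pd C k), pd_add ((hM A i).pd C k) ((hM A i).pd C k),
      pd_comm (hM A j), pd_comm (hM A i)] at h
    funext p
    have := congrFun h p
    simp only [Pi.add_apply, Pi.zero_apply] at this ⊢
    linarith
  have hS_compat {i j l : Fin n} (hi : i ∈ s) (hj : j ∈ s) (hl : l ∈ s) (A B C : Fin N) :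
      pd B i (pd A j (M C l)) + pd B j (pd A i (M C l)) = pd C l (S A B i j) := by
    have h := hL.int2 i j l k A B C
    simp only [hs i hi j hj, hs l hl j hj, hs l hl i hi, pd_zero, add_zero, hL.symm k] at h
    simp only [pd_add ((hM _ _).pd _ _) ((hM _ _).pd _ _), S]
    rw [pd_comm (hM C l) B A, pd_comm (hM C l) B A, pd_comm (hM A j) C B,
      pd_comm (hM A i) C B, add_comm]
    exact h.symm
  have hv_hess {i j : Fin n} (hi : i ∈ s) (hj : j ∈ s) (A B : Fin N) :
      pd B i (pd A j v) + pd B j (pd A i v) = S A B i j := by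
    funext p
    refine (symmetrized_hessian_homotopy hM A B (by simp [a', hi]) (by simp [b', hi])
      (by simp [a', hj]) (by simp [b', hj]) (hS_symm hi hj A B)
      (fun C ρ hρ => hS_compat hi hj (hb' hρ) A B C) p).trans ?_
    have hscale : scale a' b' 1 p = scale (1 - b) b 0 p := by
      refine Prod.ext rfl (Prod.ext rfl ?_)
      funext A μ
      by_cases hμ : μ = k
      · subst hμ
        simp [scale, a', b', b, hk]
      · by_cases hμs : μ ∈ s <;> simp [scale, a', b', b, hμ, hμs]
    change S A B i j (scale a' b' 1 p) = _
    rw [hscale, comp_scale_eq (hS A B i j) (fun C μ hμ => by rw [hb hμ, hS_indep hi hj]) 0 1,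
      scale_eq_self (by simp)]
  let Q : Fin n → J n N → ℝ := fun i => homotopy (1 - b) b fun A _ => M A i
  have hQ (i : Fin n) : ContDiff ℝ ∞ (Q i) := contDiff_homotopy fun A _ => hM A i
  have hQk {i : Fin n} (A : Fin N) : pd A k (Q i) = M A i := by
    refine pd_homotopy_of_closed (fun A _ => hM A i) hab hbk fun B μ hμ => ?_
    obtain rfl := hb hμ
    have h := hL.int1 i μ μ B A
    simp only [hkk, pd_zero, add_zero] at h
    funext p
    have := congrFun h p
    simp only [Pi.add_apply] at this
    simp only [M]
    linarith
  have hQs {i j : Fin n} (hi : i ∈ s) (hj : j ∈ s) (B : Fin N) :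
      pd B i (Q j) + pd B j (Q i) = ∑ A, coord A k * S A B i j := by
    rw [pd_homotopy_of_fixed (fun A _ => hM A j) B (by simp [b, hne hi]) (by simp [b, hne hi]),
      pd_homotopy_of_fixed (fun A _ => hM A i) B (by simp [b, hne hj]) (by simp [b, hne hj]),
      homotopy_add (fun A _ => (hM A j).pd B i) (fun A _ => (hM A i).pd B j)]
    refine (homotopy_of_const (g := fun A _ => S A B i j) (fun A _ => hS A B i j) hab
      fun A C _ ν _ hν => by rw [hb hν, hS_indep hi hj]).trans ?_
    refine Finset.sum_congr rfl fun A _ => ?_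
    rw [Finset.sum_eq_single k (fun μ _ hμ => by simp [b, hμ]) (by simp), hbk, one_smul]
  let R : Fin n → J n N → ℝ := fun i => ∑ A, coord A k * pd A i v
  have hR' (i A) : ContDiff ℝ ∞ (coord A k * pd A i v) := (contDiff_coord A k).mul (hv.pd A i)
  have hR (i : Fin n) : ContDiff ℝ ∞ (R i) := contDiff_finset_sum _ (hR' i)
  have hRk (i : Fin n) (B : Fin N) : pd B k (R i) = pd B i v := by
    simp only [R, pd_sum _ (hR' i), pd_mul (contDiff_coord _ _) (hv.pd _ _), pd_coord,
      pd_comm hv B _ k i, hvk, pd_zero]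
    funext p
    simp [Finset.sum_apply]
  have hRs {i : Fin n} (hi : i ∈ s) (j : Fin n) (B : Fin N) :
      pd B i (R j) = ∑ A, coord A k * pd B i (pd A j v) := by
    simp only [R, pd_sum _ (hR' j), pd_mul (contDiff_coord _ _) (hv.pd _ _), pd_coord]
    funext p
    simp [Finset.sum_apply, (hne hi).symm]
  let V : Fin n → J n N → ℝ := fun μ => if μ = k then v else Q μ - R μ
  have hVk : V k = v := by simp [V]
  have hVs {i : Fin n} (hi : i ∈ s) : V i = Q i - R i := by simp [V, hne hi]
  have hoff {i : Fin n} (hi : i ∈ s) (A : Fin N) : L i k A = symGrad V i k A := by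
    rw [symGrad, hVk, hVs hi, pd_sub (hQ i) (hR i), hQk, hRk]
    simp [M]
  refine ⟨V, fun μ => ?_, fun i hi j hj A => ?_⟩
  · by_cases h : μ = k
    · simpa [V, h] using hv
    · simp only [V, if_neg h]
      exact (hQ μ).sub (hR μ)
  · rcases Finset.mem_insert.1 hi with hik | his <;>
      rcases Finset.mem_insert.1 hj with hjk | hjs
    · subst hik hjk
      rw [hkk, symGrad, hVk, hvk, add_zero]
    · rw [hik, hL.symm, symGrad_comm, hoff hjs]
    · rw [hjk, hoff his]
    · rw [hs i his j hjs, symGrad, hVs his, hVs hjs, pd_sub (hQ j) (hR j),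
        pd_sub (hQ i) (hR i), hRs his, hRs hjs, sub_add_sub_comm, hQs his hjs,
        ← Finset.sum_add_distrib]
      simp only [← mul_add, hv_hess his hjs, sub_self]

theorem IsIntegrable.exists_symGrad_on {L : Fin n → Fin n → Fin N → J n N → ℝ}
    (hL : IsIntegrable L) (s : Finset (Fin n)) :
    ∃ V : Fin n → J n N → ℝ, (∀ μ, ContDiff ℝ ∞ (V μ)) ∧
      ∀ i ∈ s, ∀ j ∈ s, ∀ A, L i j A = symGrad V i j A := by
  classical
  induction s using Finset.induction_on with
  | empty => exact ⟨0, fun _ => contDiff_const, by simp⟩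
  | insert k s hk ih =>
    obtain ⟨V₁, hV₁, h₁⟩ := ih
    have hL₁ := hL.sub (isIntegrable_symGrad hV₁)
    obtain ⟨V₂, hV₂, hz, h₂⟩ := exists_symGrad_diag hL₁ k
    have hL₂ := hL₁.sub (isIntegrable_symGrad hV₂)
    have hne {i : Fin n} (hi : i ∈ s) : i ≠ k := fun h => hk (h ▸ hi)
    obtain ⟨V₃, hV₃, h₃⟩ := exists_symGrad_offDiag hL₂ hk
      (fun i hi j hj A => by
        simp [symGrad, hz i (hne hi), hz j (hne hj), pd_zero, h₁ i hi j hj])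
      (fun A => by simpa [sub_eq_zero] using h₂ A)
    have h₁₂ : ∀ μ, ContDiff ℝ ∞ ((V₁ + V₂) μ) := fun μ => (hV₁ μ).add (hV₂ μ)
    refine ⟨V₁ + V₂ + V₃, fun μ => (h₁₂ μ).add (hV₃ μ), fun i hi j hj A => ?_⟩
    rw [symGrad_add h₁₂ hV₃, symGrad_add hV₁ hV₂]
    simp only [Pi.add_apply, ← h₃ i hi j hj A, Pi.sub_apply]
    abel

end OrderReduction

theorem order_reduction_Tn (n N : ℕ) (hn : 0 < n) (hN : 0 < N)
    (L : Fin n → Fin n → Fin N → J n N → ℝ)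
    (hLsmooth : ∀ μ ν A, ContDiff ℝ (⊤ : ℕ∞) (L μ ν A))
    (hLsym : ∀ μ ν A, L μ ν A = L ν μ A)
    (hint1 : ∀ (μ ν ρ : Fin n) (A B : Fin N) (p : J n N),
      pd B ρ (L μ ν A) p + pd B μ (L ρ ν A) p + pd B ν (L μ ρ A) p =
      pd A ρ (L μ ν B) p + pd A μ (L ρ ν B) p + pd A ν (L μ ρ B) p)
    (hint2 : ∀ (μ ν ρ σ : Fin n) (A B C : Fin N) (p : J n N),
      pd B μ (fun q => pd C ρ (L σ ν A) q + pd C σ (L ρ ν A) q) p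
      + pd B ν (fun q => pd C ρ (L σ μ A) q + pd C σ (L ρ μ A) q) p
      - (pd A μ (pd B ν (L σ ρ C)) p + pd A ν (pd B μ (L σ ρ C)) p)
      - (pd A ρ (pd C σ (L μ ν B)) p + pd A σ (pd C ρ (L μ ν B)) p) = 0) :
    ∃ V : Fin n → J n N → ℝ,
      (∀ μ, ContDiff ℝ (⊤ : ℕ∞) (V μ)) ∧
      (∀ (μ ν : Fin n) (A : Fin N) (p : J n N),
        L μ ν A p = pd A μ (V ν) p + pd A ν (V μ) p) := by
  have hL : IsIntegrable L := by
    refine ⟨hLsmooth, hLsym, fun μ ν ρ A B => funext (hint1 μ ν ρ A B),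
      fun μ ν ρ σ A B C => funext fun p => ?_⟩
    have h := hint2 μ ν ρ σ A B C p
    simp only [Pi.add_apply]
    change pd B μ (pd C ρ (L σ ν A) + pd C σ (L ρ ν A)) p
      + pd B ν (pd C ρ (L σ μ A) + pd C σ (L ρ μ A)) p - _ - _ = 0 at h
    linarith
  obtain ⟨V, hV, h⟩ := hL.exists_symGrad_on Finset.univ
  exact ⟨V, hV, fun μ ν A p => congrFun (h μ (Finset.mem_univ μ) ν (Finset.mem_univ ν) A) p⟩
end

section
/- Corollary (C_n): Let t^{μν}_{AB} (μ,ν = 1,…,n; A,B = 1,…,N) be first-order functions satisfying (eq1), (eq2), (eq4) and (eq7). Then there exists a first-order function L such that t^{μν}_{AB} = −(1/2)(∂^μ_A ∂^ν_B + ∂^ν_A ∂^μ_B) L for all μ, ν, A, B. -/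
/-- Commuting linear operators `d e` on `F`, each with a linear right inverse `S e` that commutes
with the other `d f`: an algebraic model of partial derivatives and partial primitives. -/
structure PartialSystem (E F : Type*) [AddCommGroup F] [Module ℝ F] where
  /-- partial derivative -/
  d : E → F →ₗ[ℝ] F
  /-- partial primitive -/
  S : E → F →ₗ[ℝ] F
  d_comm : ∀ e f a, d e (d f a) = d f (d e a)
  d_S_self : ∀ e a, d e (S e a) = a
  d_S_of_ne : ∀ e f a, e ≠ f → d e (S f a) = S f (d e a)

namespace PartialSystem

section Operators

variable {E F : Type*} [AddCommGroup F] [Module ℝ F] (X : PartialSystem E F)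

lemma d_S_S_of_ne {e p q : E} (hp : e ≠ p) (hq : e ≠ q) (a : F) :
    X.d e (X.S p (X.S q a)) = X.S p (X.S q (X.d e a)) := by
  rw [X.d_S_of_ne _ _ _ hp, X.d_S_of_ne _ _ _ hq]

lemma d_d_S_S_self (p q : E) (a : F) : X.d p (X.d q (X.S p (X.S q a))) = a := by
  rw [X.d_comm, X.d_S_self, X.d_S_self]

/-- Freezing the variables in a finite set at zero. -/
lemma exists_freeze [DecidableEq E] (s : Finset E) : ∃ Z : F →ₗ[ℝ] F,
    (∀ e ∈ s, ∀ a, X.d e (Z a) = 0) ∧ (∀ e ∉ s, ∀ a, X.d e (Z a) = Z (X.d e a)) ∧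
      ∀ a, (∀ e ∈ s, X.d e a = 0) → Z a = a := by
  induction s using Finset.induction_on with
  | empty => exact ⟨LinearMap.id, by simp, by simp, by simp⟩
  | insert f s hf ih =>
    obtain ⟨Z, h₁, h₂, h₃⟩ := ih
    refine ⟨(LinearMap.id - X.S f ∘ₗ X.d f) ∘ₗ Z, ?_, ?_, ?_⟩
    · intro e he a
      by_cases hef : e = f
      · subst hef
        simp [X.d_S_self]
      · have he' : e ∈ s := by simpa [hef] using he
        simp [X.d_S_of_ne _ _ _ hef, X.d_comm e f, h₁ e he']
    · intro e he a
      obtain ⟨hef, he'⟩ : e ≠ f ∧ e ∉ s := by simpa using he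
      simp [X.d_S_of_ne _ _ _ hef, X.d_comm e f, h₂ e he']
    · intro a ha
      have hZ : Z a = a := h₃ a fun e he => ha e (Finset.mem_insert_of_mem he)
      simp [hZ, ha f (Finset.mem_insert_self f s)]

end Operators

variable {α β F : Type*} [AddCommGroup F] [Module ℝ F] (X : PartialSystem (α × β) F)

/-- The permanental second-order operator `(∂ᵘ_A ∂ᵛ_B + ∂ᵛ_A ∂ᵘ_B) L`. -/
def perm (L : F) (μ ν : β) (A B : α) : F :=
  X.d (A, μ) (X.d (B, ν) L) + X.d (A, ν) (X.d (B, μ) L)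

/-- The symmetry, first-order and second-order conditions satisfied by the families `X.perm L`. -/
structure Compatible (t : β → β → α → α → F) : Prop where
  symm_col : ∀ μ ν A B, t μ ν A B = t ν μ A B
  symm_row : ∀ μ ν A B, t μ ν A B = t μ ν B A
  first : ∀ μ ν ρ A B C, X.d (C, ρ) (t μ ν A B) + X.d (B, ρ) (t μ ν A C) =
    X.d (A, μ) (t ρ ν B C) + X.d (A, ν) (t ρ μ B C)
  second : ∀ μ ν ρ σ A B C D, X.perm (t ρ σ A D) μ ν B C = X.perm (t μ ν B C) ρ σ A D

lemma perm_sub (a b : F) (μ ν : β) (A B : α) :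
    X.perm (a - b) μ ν A B = X.perm a μ ν A B - X.perm b μ ν A B := by
  simp only [perm, map_sub]; abel

lemma perm_add (a b : F) (μ ν : β) (A B : α) :
    X.perm (a + b) μ ν A B = X.perm a μ ν A B + X.perm b μ ν A B := by
  simp only [perm, map_add]; abel

lemma perm_zero (μ ν : β) (A B : α) : X.perm 0 μ ν A B = 0 := by simp [perm]

lemma compatible_perm (L : F) : X.Compatible (X.perm L) where
  symm_col μ ν A B := by simp only [perm]; abel
  symm_row μ ν A B := by
    simp only [perm, X.d_comm (B, _) (A, _)]; abel
  first μ ν ρ A B C := by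
    have h := X.d_comm
    simp only [perm, map_add, h (C, _) (A, _), h (C, _) (B, _), h (B, _) (A, _)]
    abel
  second μ ν ρ σ A B C D := by
    have h (p q e f : α × β) : X.d p (X.d q (X.d e (X.d f L))) =
        X.d e (X.d f (X.d p (X.d q L))) := by
      rw [X.d_comm q e, X.d_comm q f, X.d_comm p e, X.d_comm p f]
    simp only [perm, map_add, h _ _ (A, _) _]
    abel

variable {X}

lemma Compatible.sub {t u : β → β → α → α → F} (ht : X.Compatible t) (hu : X.Compatible u) :
    X.Compatible (t - u) where
  symm_col μ ν A B := by simp [ht.symm_col μ ν, hu.symm_col μ ν]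
  symm_row μ ν A B := by simp [ht.symm_row μ ν A, hu.symm_row μ ν A]
  first μ ν ρ A B C := by
    have h₁ := ht.first μ ν ρ A B C
    have h₂ := hu.first μ ν ρ A B C
    simp only [Pi.sub_apply, map_sub]
    linear_combination (norm := module) h₁ - h₂
  second μ ν ρ σ A B C D := by
    simp only [Pi.sub_apply, perm_sub, ht.second μ ν ρ σ A, hu.second μ ν ρ σ A]

lemma Compatible.d {t : β → β → α → α → F} (ht : X.Compatible t) (e : α × β) :
    X.Compatible (fun μ ν A B => X.d e (t μ ν A B)) where
  symm_col μ ν A B := by rw [ht.symm_col]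
  symm_row μ ν A B := by rw [ht.symm_row]
  first μ ν ρ A B C := by
    have h := congrArg (X.d e) (ht.first μ ν ρ A B C)
    simpa only [map_add, X.d_comm e] using h
  second μ ν ρ σ A B C D := by
    have h := congrArg (X.d e) (ht.second μ ν ρ σ A B C D)
    simpa only [perm, map_add, X.d_comm e] using h

/-- If finitely many goals can be reached one at a time without destroying those already reached,
they can be reached simultaneously. -/
lemma exists_reach {T ι : Type*} [Finite ι] {r : T → T → Prop} (hrefl : ∀ t, r t t)
    (htrans : ∀ t u v, r t u → r u v → r t v) {Q : T → Prop} {P : ι → T → Prop}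
    (step : ∀ t, Q t → ∀ i, ∃ u, r t u ∧ Q u ∧ P i u ∧ ∀ j, P j t → P j u) (t : T) (ht : Q t) :
    ∃ u, r t u ∧ Q u ∧ ∀ i, P i u := by
  classical
  cases nonempty_fintype ι
  suffices h : ∀ s : Finset ι, ∃ u, r t u ∧ Q u ∧ ∀ i ∈ s, P i u by
    simpa using h Finset.univ
  intro s
  induction s using Finset.induction_on with
  | empty => exact ⟨t, hrefl t, ht, by simp⟩
  | insert i s _ ih =>
    obtain ⟨u, h₁, h₂, h₃⟩ := ih
    obtain ⟨v, k₁, k₂, k₃, k₄⟩ := step u h₂ i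
    refine ⟨v, htrans _ _ _ h₁ k₁, k₂, fun j hj => ?_⟩
    rcases Finset.mem_insert.1 hj with rfl | hj
    · exact k₃
    · exact k₄ j (h₃ j hj)

/-- Two variables in the same row or in the same column. -/
def Collinear (e f : α × β) : Prop := e.1 = f.1 ∨ e.2 = f.2

/-- The component of `t` attached to a pair of variables. -/
def comp (t : β → β → α → α → F) (e f : α × β) : F := t e.2 f.2 e.1 f.1

lemma Compatible.comp_comm {t : β → β → α → α → F} (ht : X.Compatible t) (e f : α × β) :
    comp t e f = comp t f e := by
  rw [comp, ht.symm_col, ht.symm_row, comp]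

lemma perm_of_collinear {e f : α × β} (h : Collinear e f) (L : F) :
    comp (X.perm L) e f = X.d e (X.d f L) + X.d e (X.d f L) := by
  obtain ⟨A, μ⟩ := e
  obtain ⟨B, ν⟩ := f
  rcases h with h | h <;> simp only at h <;> subst h <;> simp [comp, perm, X.d_comm]

lemma d_perm (e : α × β) (L : F) (μ ν : β) (A B : α) :
    X.d e (X.perm L μ ν A B) = X.perm (X.d e L) μ ν A B := by
  simp only [perm, map_add, X.d_comm e]

variable (X) in
/-- `L` only depends on the variables with row in `R` and column in `K`. -/
def Supported (R : Finset α) (K : Finset β) (L : F) : Prop :=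
  ∀ A μ, A ∉ R ∨ μ ∉ K → X.d (A, μ) L = 0

lemma Supported.mono {R R' : Finset α} {K K' : Finset β} {L : F} (h : X.Supported R K L)
    (hR : R ⊆ R') (hK : K ⊆ K') : X.Supported R' K' L :=
  fun A μ hA => h A μ (hA.imp (fun k l => k (hR l)) (fun k l => k (hK l)))

lemma supported_zero (R : Finset α) (K : Finset β) : X.Supported R K 0 :=
  fun _ _ _ => map_zero _

lemma Supported.add {R : Finset α} {K : Finset β} {L M : F} (hL : X.Supported R K L)
    (hM : X.Supported R K M) : X.Supported R K (L + M) :=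
  fun A μ h => by rw [map_add, hL A μ h, hM A μ h, add_zero]

lemma Supported.sub {R : Finset α} {K : Finset β} {L M : F} (hL : X.Supported R K L)
    (hM : X.Supported R K M) : X.Supported R K (L - M) :=
  fun A μ h => by rw [map_sub, hL A μ h, hM A μ h, sub_zero]

lemma Supported.d {R : Finset α} {K : Finset β} {L : F} (hL : X.Supported R K L) (e : α × β) :
    X.Supported R K (X.d e L) :=
  fun A μ h => by rw [X.d_comm, hL A μ h, map_zero]

lemma Supported.S {R : Finset α} {K : Finset β} {L : F} (hL : X.Supported R K L) {A : α} {μ : β}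
    (hA : A ∈ R) (hμ : μ ∈ K) : X.Supported R K (X.S (A, μ) L) := fun B ν h => by
  have hne : (B, ν) ≠ (A, μ) := by rintro ⟨⟩; tauto
  rw [X.d_S_of_ne _ _ _ hne, hL B ν h, map_zero]

lemma Supported.perm {R : Finset α} {K : Finset β} {L : F} (hL : X.Supported R K L) (μ ν : β)
    (A B : α) : X.Supported R K (X.perm L μ ν A B) :=
  ((hL.d _).d _).add ((hL.d _).d _)

variable (X) in
/-- Compatible families, living on the rows `R` and columns `K`, whose components attached to
pairs of collinear variables vanish. -/
structure Admissible (R : Finset α) (K : Finset β) (t : β → β → α → α → F) : Prop where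
  compatible : X.Compatible t
  collinear : ∀ e f, Collinear e f → comp t e f = 0
  row_zero : ∀ μ ν A B, A ∉ R → t μ ν A B = 0
  col_zero : ∀ μ ν A B, μ ∉ K → t μ ν A B = 0
  supported : ∀ μ ν A B, X.Supported R K (t μ ν A B)

lemma Compatible.d_comp_of_collinear {t : β → β → α → α → F} (ht : X.Compatible t)
    {e f g : α × β} (hf : Collinear e f) (hg : Collinear e g) :
    X.d g (comp t e f) = X.d f (comp t e g) := by
  have : IsAddTorsionFree F := .of_isTorsionFree ℝ F
  obtain ⟨A, μ⟩ := e
  obtain ⟨B, ν⟩ := f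
  obtain ⟨C, ρ⟩ := g
  have h₀ := ht.first
  have h₁ := ht.symm_col
  have h₂ := ht.symm_row
  rcases hf with h | h <;> rcases hg with k | k <;> simp only at h k <;> subst h <;> subst k <;>
    simp only [comp]
  · have a₁ := h₀ μ ν ρ A A A
    have a₂ := h₀ μ ρ ν A A A
    grind
  · have a₁ := h₀ μ μ ν A A C
    have a₂ := h₀ μ ν μ C A A
    have a₃ := h₀ μ ν μ A A C
    have a₄ := h₀ μ μ ν C A A
    grind
  · have a₁ := h₀ μ μ ρ A A B
    have a₂ := h₀ μ ρ μ B A A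
    have a₃ := h₀ μ ρ μ A A B
    have a₄ := h₀ μ μ ρ B A A
    grind
  · have a₁ := h₀ μ μ μ A B C
    have a₂ := h₀ μ μ μ B A C
    have a₃ := h₀ μ μ μ C A B
    grind

lemma Compatible.d_d_comp_of_collinear {t : β → β → α → α → F} (ht : X.Compatible t)
    {e f e' f' : α × β} (h : Collinear e f) (h' : Collinear e' f') :
    X.d e' (X.d f' (comp t e f)) = X.d e (X.d f (comp t e' f')) := by
  have : IsAddTorsionFree F := .of_isTorsionFree ℝ F
  have key := ht.second e'.2 f'.2 e.2 f.2 e.1 e'.1 f'.1 f.1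
  change comp (X.perm (comp t e f)) e' f' = comp (X.perm (comp t e' f')) e f at key
  rw [perm_of_collinear h, perm_of_collinear h'] at key
  grind

lemma Compatible.d_d_S_S_eq_zero {t : β → β → α → α → F} (ht : X.Compatible t)
    {e f e' f' : α × β} (h : Collinear e f) (h' : Collinear e' f') (h₀ : comp t e' f' = 0) :
    X.d e' (X.d f' (X.S e (X.S f (comp t e f)))) = 0 := by
  have fst {f'} (h' : Collinear e f') (h₀ : comp t e f' = 0) :
      X.d f' (X.d e (X.S e (X.S f (comp t e f)))) = 0 := by
    rw [X.d_S_self]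
    by_cases hf : f' = f
    · rw [← hf, h₀, map_zero, map_zero]
    · rw [X.d_S_of_ne _ _ _ hf, ht.d_comp_of_collinear h h', h₀, map_zero, map_zero]
  have hsymm : Collinear f e := h.imp Eq.symm Eq.symm
  have snd {f'} (h' : Collinear f f') (h₀ : comp t f f' = 0) :
      X.d f' (X.d f (X.S e (X.S f (comp t e f)))) = 0 := by
    by_cases hef : f = e
    · subst hef
      exact fst h' h₀
    rw [X.d_S_of_ne _ _ _ hef, X.d_S_self, ht.comp_comm e f]
    by_cases hf : f' = e
    · rw [← hf, h₀, map_zero, map_zero]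
    · rw [X.d_S_of_ne _ _ _ hf, ht.d_comp_of_collinear hsymm h', h₀, map_zero, map_zero]
  have h'' : Collinear f' e' := h'.imp Eq.symm Eq.symm
  have h₁ : comp t f' e' = 0 := by rw [ht.comp_comm, h₀]
  by_cases e₁ : e' = e
  · subst e₁; rw [X.d_comm]; exact fst h' h₀
  by_cases e₂ : e' = f
  · subst e₂; rw [X.d_comm]; exact snd h' h₀
  by_cases e₃ : f' = e
  · subst e₃; exact fst h'' h₁
  by_cases e₄ : f' = f
  · subst e₄; exact snd h'' h₁
  rw [X.d_S_S_of_ne e₃ e₄, X.d_S_S_of_ne e₁ e₂, ht.d_d_comp_of_collinear h h', h₀]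
  simp only [map_zero]

theorem Compatible.exists_collinear_eq_zero [Finite α] [Finite β] {t : β → β → α → α → F}
    (ht : X.Compatible t) : ∃ L : F, X.Compatible (t - X.perm L) ∧
      ∀ e f, Collinear e f → comp (t - X.perm L) e f = 0 := by
  obtain ⟨u, ⟨L, rfl⟩, h₁, h₂⟩ := exists_reach (ι := (α × β) × (α × β))
    (r := fun t u => ∃ L : F, u = t - X.perm L) (Q := X.Compatible)
    (P := fun i t => Collinear i.1 i.2 → comp t i.1 i.2 = 0)
    (fun t => ⟨0, by ext; simp [perm_zero]⟩)
    (by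
      rintro t _ _ ⟨L, rfl⟩ ⟨M, rfl⟩
      exact ⟨L + M, by ext; simp only [Pi.sub_apply, perm_add]; abel⟩)
    (by
      rintro t ht ⟨e, f⟩
      by_cases h : Collinear e f
      swap
      · exact ⟨t, ⟨0, by ext; simp [perm_zero]⟩, ht, fun h' => absurd h' h, fun _ => id⟩
      refine ⟨_, ⟨(2⁻¹ : ℝ) • X.S e (X.S f (comp t e f)), rfl⟩, ht.sub (X.compatible_perm _),
        fun _ => ?_, ?_⟩
      · change comp t e f - comp (X.perm _) e f = 0
        rw [perm_of_collinear h, map_smul, map_smul, X.d_d_S_S_self]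
        module
      · rintro ⟨e', f'⟩ h₁ h'
        change comp t e' f' - comp (X.perm _) e' f' = 0
        rw [perm_of_collinear h', map_smul, map_smul, ht.d_d_S_S_eq_zero h h' (h₁ h'), h₁ h']
        simp) t ht
  exact ⟨L, h₁, fun e f => h₂ (e, f)⟩

namespace Admissible

variable {R : Finset α} {K : Finset β} {t : β → β → α → α → F}

lemma row_self (h : X.Admissible R K t) (μ ν : β) (A : α) : t μ ν A A = 0 :=
  h.collinear (A, μ) (A, ν) (Or.inl rfl)

lemma col_self (h : X.Admissible R K t) (μ : β) (A B : α) : t μ μ A B = 0 :=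
  h.collinear (A, μ) (B, μ) (Or.inr rfl)

lemma sub_perm (h : X.Admissible R K t) {L : F} (hL : X.Supported R K L)
    (hc : ∀ e f, Collinear e f → X.d e (X.d f L) = 0) : X.Admissible R K (t - X.perm L) where
  compatible := h.compatible.sub (X.compatible_perm L)
  collinear e f hef := by
    change comp t e f - comp (X.perm L) e f = 0
    rw [perm_of_collinear hef, hc e f hef, h.collinear e f hef]
    simp
  row_zero μ ν A B hA := by
    simp [perm, h.row_zero μ ν A B hA, hL.d _ A _ (Or.inl hA)]
  col_zero μ ν A B hμ := by
    simp [perm, h.col_zero μ ν A B hμ, hL.d _ A μ (Or.inr hμ), hL B μ (Or.inr hμ)]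
  supported μ ν A B := (h.supported μ ν A B).sub (hL.perm μ ν A B)

lemma d_d_of_collinear (h : X.Admissible R K t) {e f : α × β} (hef : Collinear e f) (μ ν : β)
    (A B : α) : X.d e (X.d f (t μ ν A B)) = 0 := by
  have : IsAddTorsionFree F := .of_isTorsionFree ℝ F
  have key := h.compatible.second e.2 f.2 μ ν A e.1 f.1 B
  change comp (X.perm (t μ ν A B)) e f = X.perm (comp t e f) μ ν A B at key
  rw [h.collinear e f hef, perm_zero, perm_of_collinear hef] at key
  grind

lemma d_of_collinear (h : X.Admissible R K t) {e f g : α × β}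
    (hg : Collinear g e ∨ Collinear g f) : X.d g (comp t e f) = 0 := by
  have : IsAddTorsionFree F := .of_isTorsionFree ℝ F
  obtain ⟨A, μ⟩ := e
  obtain ⟨B, ν⟩ := f
  obtain ⟨C, ρ⟩ := g
  have h₀ := h.compatible.first
  have h₁ := h.compatible.symm_col
  have h₂ := h.compatible.symm_row
  have row (A B : α) (μ ν ρ : β) : X.d (A, ρ) (t μ ν A B) = 0 := by
    have a := h₀ μ ν ρ B A A
    rw [h.row_self, h.row_self, h₂ μ ν B A] at a
    simp only [map_zero] at a
    grind
  have col (A B C : α) (μ ν : β) : X.d (C, μ) (t μ ν A B) = 0 := by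
    have a := h₀ μ μ ν C A B
    rw [h.col_self, h.col_self, h₁ ν μ A B] at a
    simp only [map_zero] at a
    grind
  rcases hg with (k | k) | (k | k) <;> simp only at k <;> subst k <;> simp only [comp]
  · exact row _ _ _ _ _
  · exact col _ _ _ _ _
  · rw [h₂]; exact row _ _ _ _ _
  · rw [h₁]; exact col _ _ _ _ _

/-- The derivative of an admissible family in a variable only involves the other rows and
columns. -/
lemma d [DecidableEq α] [DecidableEq β] {a : α} {b : β}
    (h : X.Admissible (insert a R) (insert b K) t) :
    X.Admissible R K (fun μ ν A B => X.d (a, b) (t μ ν A B)) where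
  compatible := h.compatible.d (a, b)
  collinear e f hef := by
    change X.d (a, b) (comp t e f) = 0
    rw [h.collinear e f hef, map_zero]
  row_zero μ ν A B hA := by
    by_cases hAa : A = a
    · exact h.d_of_collinear (e := (A, μ)) (f := (B, ν)) (Or.inl (Or.inl hAa.symm))
    · rw [h.row_zero μ ν A B (by simp [hAa, hA]), map_zero]
  col_zero μ ν A B hμ := by
    by_cases hμb : μ = b
    · exact h.d_of_collinear (e := (A, μ)) (f := (B, ν)) (Or.inl (Or.inr hμb.symm))
    · rw [h.col_zero μ ν A B (by simp [hμb, hμ]), map_zero]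
  supported μ ν A B C ρ hC := by
    by_cases k : Collinear (C, ρ) (a, b)
    · exact h.d_d_of_collinear k μ ν A B
    · rw [X.d_comm, h.supported μ ν A B C ρ, map_zero]
      simp only [Collinear, not_or] at k
      simpa [k.1, k.2] using hC

variable (X) in
/-- `u` differs from `t` by the image of a function supported on the rows `R` and columns `K`. -/
def Step (R : Finset α) (K : Finset β) (t u : β → β → α → α → F) : Prop :=
  ∃ L, X.Supported R K L ∧ u = t - X.perm L

lemma Step.refl (t : β → β → α → α → F) : Step X R K t t :=
  ⟨0, supported_zero R K, by ext; simp [perm_zero]⟩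

lemma Step.trans (t u v : β → β → α → α → F) :
    Step X R K t u → Step X R K u v → Step X R K t v := by
  rintro ⟨L, hL, rfl⟩ ⟨M, hM, rfl⟩
  exact ⟨L + M, hL.add hM, by ext; simp only [Pi.sub_apply, perm_add]; abel⟩

lemma exists_d_eq_zero [DecidableEq α] [DecidableEq β] {a : α} {b : β} (ha : a ∉ R) (hb : b ∉ K)
    (ih : ∀ t, X.Admissible R K t → ∃ L, X.Supported R K L ∧ t = X.perm L)
    (h : X.Admissible (insert a R) (insert b K) t) :
    ∃ u, Step X (insert a R) (insert b K) t u ∧ X.Admissible (insert a R) (insert b K) u ∧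
      ∀ μ ν A B, X.d (a, b) (u μ ν A B) = 0 := by
  have : IsAddTorsionFree F := .of_isTorsionFree ℝ F
  obtain ⟨M, hM, hm⟩ := ih _ h.d
  have hM' : X.Supported (insert a R) (insert b K) M :=
    hM.mono (Finset.subset_insert _ _) (Finset.subset_insert _ _)
  have hL := hM'.S (Finset.mem_insert_self a R) (Finset.mem_insert_self b K)
  have hline {f : α × β} (hf : Collinear (a, b) f) : X.d f M = 0 := by
    refine hM f.1 f.2 (hf.imp ?_ ?_) <;> intro k <;> simp only at k <;> rwa [← k]
  have hM₂ {e f : α × β} (hef : Collinear e f) : X.d e (X.d f M) = 0 := by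
    have k : X.d (a, b) (comp t e f) = comp (X.perm M) e f :=
      congrFun (congrFun (congrFun (congrFun hm e.2) f.2) e.1) f.1
    rw [h.collinear e f hef, map_zero, perm_of_collinear hef] at k
    grind
  refine ⟨_, ⟨_, hL, rfl⟩, h.sub_perm hL ?_, ?_⟩
  · intro e f hef
    by_cases he : e = (a, b)
    · subst he
      rw [X.d_comm, X.d_S_self, hline hef]
    by_cases hf : f = (a, b)
    · subst hf
      rw [X.d_S_self, hline (hef.imp Eq.symm Eq.symm)]
    rw [X.d_S_of_ne _ _ _ hf, X.d_S_of_ne _ _ _ he, hM₂ hef, map_zero]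
  · intro μ ν A B
    simp only [Pi.sub_apply]
    rw [map_sub, d_perm, X.d_S_self, ← hm, sub_self]

lemma exists_cross_eq_zero [Finite α] [Finite β] {a : α} {b : β} (haR : a ∈ R) (hbK : b ∈ K)
    (h : X.Admissible R K t) (hd : ∀ μ ν A B, X.d (a, b) (t μ ν A B) = 0) :
    ∃ u, Step X R K t u ∧ (X.Admissible R K u ∧ ∀ μ ν A B, X.d (a, b) (u μ ν A B) = 0) ∧
      ∀ i : α × β, u b i.2 a i.1 = 0 := by
  refine exists_reach Step.refl Step.trans (fun t ⟨h, hd⟩ ⟨D, σ⟩ => ?_) t ⟨h, hd⟩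
  set g := t b σ a D with hg
  by_cases h₀ : g = 0
  · exact ⟨t, Step.refl t, ⟨h, hd⟩, h₀, fun _ => id⟩
  have haD : a ≠ D := by rintro rfl; exact h₀ (h.row_self _ _ _)
  have hbσ : b ≠ σ := by rintro rfl; exact h₀ (h.col_self _ _ _)
  have hD : D ∈ R := by
    by_contra k
    exact h₀ (by rw [hg, h.compatible.symm_row, h.row_zero _ _ _ _ k])
  have hσ : σ ∈ K := by
    by_contra k
    exact h₀ (by rw [hg, h.compatible.symm_col, h.col_zero _ _ _ _ k])
  have hgl {f : α × β} (hf : f.1 = a ∨ f.1 = D ∨ f.2 = b ∨ f.2 = σ) : X.d f g = 0 := by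
    refine h.d_of_collinear (e := (a, b)) (f := (D, σ)) ?_
    simp only [Collinear]; tauto
  set L := X.S (a, σ) (X.S (D, b) g) with hLdef
  have hL : X.Supported R K L := ((h.supported b σ a D).S hD hbK).S haR hσ
  have hdL {f : α × β} (hf : f.1 = a ∨ f.1 = D ∨ f.2 = b ∨ f.2 = σ) (h₁ : f ≠ (a, σ))
      (h₂ : f ≠ (D, b)) : X.d f L = 0 := by
    rw [hLdef, X.d_S_S_of_ne h₁ h₂, hgl hf, map_zero, map_zero]
  have hne : (a, σ) ≠ (D, b) := by simp [haD]
  have hline₁ {f : α × β} (hf : Collinear (a, σ) f) : X.d f (X.d (a, σ) L) = 0 := by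
    have k : f ≠ (D, b) := by rintro rfl; rcases hf with k | k <;> simp_all
    rw [hLdef, X.d_S_self, X.d_S_of_ne _ _ _ k, hgl, map_zero]
    rcases hf with k | k <;> simp only at k <;> simp [k]
  have hline₂ {f : α × β} (hf : Collinear (D, b) f) : X.d f (X.d (D, b) L) = 0 := by
    have k : f ≠ (a, σ) := by rintro rfl; rcases hf with k | k <;> simp_all
    rw [hLdef, X.d_S_of_ne _ _ _ hne.symm, X.d_S_self, X.d_S_of_ne _ _ _ k, hgl, map_zero]
    rcases hf with k | k <;> simp only at k <;> simp [k]
  refine ⟨_, ⟨L, hL, rfl⟩, ⟨h.sub_perm hL ?_, ?_⟩, ?_, ?_⟩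
  · intro e f hef
    have hfe : Collinear f e := hef.imp Eq.symm Eq.symm
    by_cases h₁ : e = (a, σ)
    · subst h₁; rw [X.d_comm, hline₁ hef]
    by_cases h₂ : e = (D, b)
    · subst h₂; rw [X.d_comm, hline₂ hef]
    by_cases h₃ : f = (a, σ)
    · subst h₃; rw [hline₁ hfe]
    by_cases h₄ : f = (D, b)
    · subst h₄; rw [hline₂ hfe]
    rw [hLdef, X.d_S_S_of_ne h₃ h₄, X.d_S_S_of_ne h₁ h₂, h.d_d_of_collinear hef, map_zero,
      map_zero]
  · intro μ ν A B
    simp only [Pi.sub_apply]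
    rw [map_sub, hd, d_perm, hdL (by simp) (by simp [hbσ]) (by simp [haD]), perm_zero, sub_zero]
  · change g - X.perm L b σ a D = 0
    rw [perm, hLdef, X.d_d_S_S_self, ← hLdef, X.d_comm,
      hdL (by simp) (by simp [hbσ]) (by simp [haD]), map_zero, zero_add, sub_self]
  · rintro ⟨B, ν⟩ hBν
    by_cases hB : B = D ∧ ν = σ
    · obtain ⟨rfl, rfl⟩ := hB
      exact absurd hBν h₀
    simp only at hBν
    simp only [Pi.sub_apply, hBν, perm, zero_sub, neg_eq_zero]
    rw [X.d_comm, hdL (by simp) (by simp [hbσ]) (by simp [haD]), map_zero, zero_add]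
    by_cases hBD : B = D
    · rw [X.d_comm, hdL (by simp) (by simp; tauto) (by simp [haD]), map_zero]
    · rw [hdL (by simp) (by simp [hbσ]) (by simp [hBD]), map_zero]

lemma freeze [DecidableEq α] [DecidableEq β] {b : β} (h : X.Admissible R (insert b K) t)
    {Z : F →ₗ[ℝ] F} (hZ : ∀ A a, X.Supported R (insert b K) a → X.d (A, b) (Z a) = 0)
    (hZ' : ∀ A μ a, μ ≠ b → X.d (A, μ) (Z a) = Z (X.d (A, μ) a)) :
    X.Admissible R K (fun μ ν A B => if μ = b ∨ ν = b then 0 else Z (t μ ν A B)) where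
  compatible :=
    { symm_col := fun μ ν A B => by simp only [or_comm, h.compatible.symm_col μ ν]
      symm_row := fun μ ν A B => by rw [h.compatible.symm_row μ ν]
      first := fun μ ν ρ A B C => by
        have k (C μ ν A B) : X.d (C, b) (Z (t μ ν A B)) = 0 := hZ _ _ (h.supported _ _ _ _)
        by_cases hμ : μ = b
        · subst hμ; by_cases hν : ν = μ <;> by_cases hρ : ρ = μ <;> simp [hν, hρ, k]
        by_cases hν : ν = b
        · subst hν; by_cases hρ : ρ = ν <;> simp [hμ, hρ, k]
        by_cases hρ : ρ = b
        · subst hρ; simp [hμ, hν, k]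
        simp only [hμ, hν, hρ, or_self, if_false, hZ' _ _ _ hμ, hZ' _ _ _ hν, hZ' _ _ _ hρ]
        simpa only [map_add] using congrArg Z (h.compatible.first μ ν ρ A B C)
      second := fun μ ν ρ σ A B C D => by
        have k (C μ ν A B) : X.d (C, b) (Z (t μ ν A B)) = 0 := hZ _ _ (h.supported _ _ _ _)
        have k' (C e μ ν A B) : X.d (C, b) (X.d e (Z (t μ ν A B))) = 0 := by
          rw [X.d_comm, k, map_zero]
        have key (μ ν ρ σ A B C D) :
            X.perm (if ρ = b ∨ σ = b then 0 else Z (t ρ σ A D)) μ ν B C =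
              if (ρ = b ∨ σ = b) ∨ μ = b ∨ ν = b then 0 else Z (X.perm (t ρ σ A D) μ ν B C) := by
          by_cases h₁ : ρ = b ∨ σ = b
          · simp [h₁, perm_zero]
          by_cases hμ : μ = b
          · subst hμ; simp [h₁, perm, k, k']
          by_cases hν : ν = b
          · subst hν; simp [h₁, perm, k, k']
          simp [h₁, hμ, hν, perm, hZ' _ _ _ hμ, hZ' _ _ _ hν]
        rw [key, key, h.compatible.second μ ν ρ σ A B C D]
        simp only [or_comm (a := ρ = b ∨ σ = b)] }
  collinear e f hef := by
    have k : t e.2 f.2 e.1 f.1 = 0 := h.collinear e f hef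
    simp [comp, k]
  row_zero μ ν A B hA := by simp [h.row_zero μ ν A B hA]
  col_zero μ ν A B hμ := by
    by_cases hb : μ = b
    · simp [hb]
    · simp [h.col_zero μ ν A B (by simp [hb, hμ])]
  supported μ ν A B C ρ hC := by
    split_ifs
    · exact map_zero _
    by_cases hb : ρ = b
    · subst hb; exact hZ _ _ (h.supported _ _ _ _)
    · rw [hZ' _ _ _ hb, h.supported μ ν A B C ρ (by simpa [hb] using hC), map_zero]

/-- If the cross of `(a, b)` has been cleared, removing a suitable potential supported on the
columns `K` clears the row `a`. -/
lemma exists_row_eq_zero [DecidableEq α] [DecidableEq β] {a : α} {b : β}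
    (ih : ∀ t, X.Admissible (insert a R) K t →
      ∃ L, X.Supported (insert a R) K L ∧ t = X.perm L)
    (h : X.Admissible (insert a R) (insert b K) t) (hd : ∀ μ ν A B, X.d (a, b) (t μ ν A B) = 0)
    (hc : ∀ D σ, t b σ a D = 0) :
    ∃ u, Step X (insert a R) (insert b K) t u ∧ X.Admissible R (insert b K) u := by
  have : IsAddTorsionFree F := .of_isTorsionFree ℝ F
  obtain ⟨Z, hZ₁, hZ₂, hZ₃⟩ := X.exists_freeze ((insert a R).image fun A => (A, b))
  have hmem (A : α) (μ : β) : (A, μ) ∈ ((insert a R).image fun A => (A, b)) ↔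
      A ∈ insert a R ∧ b = μ := by
    simp only [Finset.mem_image, Prod.mk.injEq]
    constructor
    · rintro ⟨x, hx, rfl, rfl⟩; exact ⟨hx, rfl⟩
    · rintro ⟨hx, rfl⟩; exact ⟨A, hx, rfl, rfl⟩
  obtain ⟨L, hL, hu⟩ := ih _ (h.freeze (Z := Z)
    (fun A x hx => by
      by_cases hA : A ∈ insert a R
      · exact hZ₁ _ ((hmem _ _).2 ⟨hA, rfl⟩) x
      · rw [hZ₂ _ (fun k => hA ((hmem _ _).1 k).1), hx A b (Or.inl hA), map_zero])
    (fun A μ x hμ => hZ₂ _ (fun k => hμ ((hmem _ _).1 k).2.symm) x))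
  have hL' := hL.mono subset_rfl (Finset.subset_insert b K)
  have hadm : X.Admissible (insert a R) (insert b K) (t - X.perm L) := by
    refine h.sub_perm hL' fun e f hef => ?_
    have k : comp (X.perm L) e f = 0 := by
      rw [← hu, comp, show t e.2 f.2 e.1 f.1 = 0 from h.collinear e f hef]
      simp
    rw [perm_of_collinear hef] at k
    grind
  have hcol (D : α) (μ ν : β) (B : α) : X.d (D, b) (t μ ν a B) = 0 := by
    have k := h.compatible.first μ ν b B a D
    rw [hd, hc, hc, map_zero, map_zero, h.compatible.symm_row μ ν B a] at k
    simpa using k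
  have hrow (μ ν : β) (B : α) : (t - X.perm L) μ ν a B = 0 := by
    rw [Pi.sub_apply, Pi.sub_apply, Pi.sub_apply, Pi.sub_apply, ← hu]
    beta_reduce
    split_ifs with k
    · rcases k with rfl | rfl
      · rw [hc, sub_zero]
      · rw [h.compatible.symm_col, hc, sub_zero]
    · rw [hZ₃, sub_self]
      rintro ⟨A, μ'⟩ he
      obtain ⟨-, rfl⟩ := (hmem _ _).1 he
      exact hcol _ _ _ _
  refine ⟨_, ⟨L, hL', rfl⟩, hadm.compatible, hadm.collinear, ?_, hadm.col_zero, ?_⟩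
  · intro μ ν A B hA
    by_cases hAa : A = a
    · rw [hAa, hrow]
    · exact hadm.row_zero μ ν A B (by simp [hAa, hA])
  · intro μ ν A B C ρ hC
    by_cases hCa : C = a
    · subst hCa
      have k := hadm.compatible.first μ ν ρ A B C
      rw [hadm.compatible.symm_row μ ν A C, hadm.compatible.symm_row ρ ν B C,
        hadm.compatible.symm_row ρ μ B C] at k
      simpa only [hrow, map_zero, add_zero] using k
    · exact hadm.supported μ ν A B C ρ (by simpa [hCa] using hC)

theorem exists_perm_eq [Finite α] [Finite β] (h : X.Admissible R K t) :
    ∃ L, X.Supported R K L ∧ t = X.perm L := by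
  classical
  induction R using Finset.induction_on generalizing K t with
  | empty =>
    refine ⟨0, supported_zero _ _, ?_⟩
    ext μ ν A B
    rw [h.row_zero μ ν A B (Finset.notMem_empty A), perm_zero]
  | insert a R ha ihR =>
    induction K using Finset.induction_on generalizing t with
    | empty =>
      refine ⟨0, supported_zero _ _, ?_⟩
      ext μ ν A B
      rw [h.col_zero μ ν A B (Finset.notMem_empty μ), perm_zero]
    | insert b K hb ihK =>
      obtain ⟨u, hu, h₁, hd⟩ := h.exists_d_eq_zero ha hb (fun _ => ihR)
      obtain ⟨v, hv, ⟨h₂, hd⟩, hc⟩ :=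
        h₁.exists_cross_eq_zero (Finset.mem_insert_self a R) (Finset.mem_insert_self b K) hd
      obtain ⟨w, hw, h₃⟩ := h₂.exists_row_eq_zero (fun _ => ihK) hd fun D σ => hc (D, σ)
      obtain ⟨L, hL, rfl⟩ := ihR h₃
      obtain ⟨M, hM, hM'⟩ := Step.trans _ _ _ (Step.trans _ _ _ hu hv) hw
      refine ⟨L + M, (hL.mono (Finset.subset_insert a R) subset_rfl).add hM, ?_⟩
      ext μ ν A B
      rw [perm_add, hM']
      simp

end Admissible

theorem Compatible.exists_perm_eq [Finite α] [Finite β] {t : β → β → α → α → F}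
    (ht : X.Compatible t) : ∃ L, t = X.perm L := by
  cases nonempty_fintype α
  cases nonempty_fintype β
  obtain ⟨L, h, hc⟩ := ht.exists_collinear_eq_zero
  have hadm : X.Admissible Finset.univ Finset.univ (t - X.perm L) :=
    ⟨h, hc, by simp, by simp, fun _ _ _ _ => by simp [Supported]⟩
  obtain ⟨M, -, hM⟩ := hadm.exists_perm_eq
  refine ⟨M + L, ?_⟩
  ext μ ν A B
  rw [perm_add, ← hM]
  simp

end PartialSystem

section ParametricIntegral

variable {E G : Type} [NormedAddCommGroup E] [NormedSpace ℝ E] [FiniteDimensional ℝ E]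
  [NormedAddCommGroup G] [NormedSpace ℝ G]

lemma hasFDerivAt_integral_of_contDiff {g : E × ℝ → G} (hg : ContDiff ℝ 1 g) (a b : ℝ) (p : E) :
    HasFDerivAt (fun p => ∫ s in a..b, g (p, s))
      (∫ s in a..b, (fderiv ℝ g (p, s)).comp (ContinuousLinearMap.inl ℝ E ℝ)) p := by
  have hc : Continuous fun q : E × ℝ => (fderiv ℝ g q).comp (ContinuousLinearMap.inl ℝ E ℝ) :=
    (hg.continuous_fderiv one_ne_zero).clm_comp continuous_const
  obtain ⟨C, hC⟩ := ((isCompact_closedBall p 1).prod (isCompact_uIcc (a := a) (b := b))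
    ).exists_bound_of_continuousOn hc.continuousOn
  refine intervalIntegral.hasFDerivAt_integral_of_dominated_of_fderiv_le (bound := fun _ => C)
    (Metric.closedBall_mem_nhds p one_pos) (.of_forall fun q => ?_) ?_ ?_ (.of_forall ?_) ?_
    (.of_forall ?_) (F' := fun p s => (fderiv ℝ g (p, s)).comp (ContinuousLinearMap.inl ℝ E ℝ))
  · exact (hg.continuous.comp (by fun_prop)).aestronglyMeasurable
  · exact (hg.continuous.comp (by fun_prop : Continuous fun s : ℝ => (p, s))).intervalIntegrable _ _
  · exact (hc.comp (by fun_prop : Continuous fun s : ℝ => (p, s))).aestronglyMeasurable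
  · exact fun s hs q hq => hC (q, s) ⟨hq, Set.uIoc_subset_uIcc hs⟩
  · exact intervalIntegrable_const
  · intro s _ q _
    exact ((hg.differentiable one_ne_zero) (q, s)).hasFDerivAt.comp q (hasFDerivAt_prodMk_left q s)

lemma contDiff_integral_of_contDiff {g : E × ℝ → G} (hg : ContDiff ℝ (⊤ : ℕ∞) g) (a b : ℝ) :
    ContDiff ℝ (⊤ : ℕ∞) fun p => ∫ s in a..b, g (p, s) := by
  suffices h : ∀ (n : ℕ) (G : Type) [NormedAddCommGroup G] [NormedSpace ℝ G] (g : E × ℝ → G),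
      ContDiff ℝ n g → ContDiff ℝ n fun p => ∫ s in a..b, g (p, s) from
    contDiff_infty.2 fun n => h n G g (contDiff_infty.1 hg n)
  clear hg g
  intro n
  induction n with
  | zero =>
    intro G _ _ g hg
    rw [Nat.cast_zero, contDiff_zero] at hg ⊢
    exact intervalIntegral.continuous_parametric_intervalIntegral_of_continuous' (by
      simpa [Function.uncurry_def] using hg) _ _
  | succ n ih =>
    intro G _ _ g hg
    have h₁ : ContDiff ℝ 1 g := hg.of_le (by exact_mod_cast Nat.le_add_left 1 n)
    have hd := hasFDerivAt_integral_of_contDiff h₁ a b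
    rw [Nat.cast_add, Nat.cast_one] at hg ⊢
    refine contDiff_succ_iff_fderiv.2 ⟨fun p => (hd p).differentiableAt, by simp, ?_⟩
    rw [funext fun p => (hd p).fderiv]
    exact ih _ _ ((contDiff_succ_iff_fderiv.1 hg).2.2.clm_comp contDiff_const)

end ParametricIntegral

section Primitive

variable {E : Type} [NormedAddCommGroup E] [NormedSpace ℝ E]

/-- Smooth real functions. -/
def smoothSubmodule (E : Type) [NormedAddCommGroup E] [NormedSpace ℝ E] :
    Submodule ℝ (E → ℝ) where
  carrier := {f | ContDiff ℝ (⊤ : ℕ∞) f}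
  add_mem' {f g} hf hg := by
    change ContDiff ℝ (⊤ : ℕ∞) f at hf
    change ContDiff ℝ (⊤ : ℕ∞) g at hg
    exact hf.add hg
  zero_mem' := by
    change ContDiff ℝ (⊤ : ℕ∞) fun _ => 0
    exact contDiff_const
  smul_mem' c f hf := by
    change ContDiff ℝ (⊤ : ℕ∞) f at hf
    exact hf.const_smul c

lemma contDiff_coe (f : smoothSubmodule E) : ContDiff ℝ (⊤ : ℕ∞) f.1 := f.2

lemma differentiableAt_coe (f : smoothSubmodule E) (p : E) : DifferentiableAt ℝ f.1 p :=
  (contDiff_coe f).differentiable (by simp) p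

/-- The directional derivative of smooth functions. -/
noncomputable def dirDeriv (v : E) : smoothSubmodule E →ₗ[ℝ] smoothSubmodule E where
  toFun f := ⟨fun p => fderiv ℝ f.1 p v, by
    change ContDiff ℝ (⊤ : ℕ∞) fun p => fderiv ℝ f.1 p v
    exact ((contDiff_coe f).fderiv_right (by simp)).clm_apply contDiff_const⟩
  map_add' f g := by
    ext p
    simp [fderiv_add (differentiableAt_coe f p) (differentiableAt_coe g p)]
  map_smul' c f := by
    ext p
    simp [fderiv_const_smul (differentiableAt_coe f p)]

lemma dirDeriv_apply (v : E) (f : smoothSubmodule E) (p : E) :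
    (dirDeriv v f).1 p = fderiv ℝ f.1 p v := rfl

lemma dirDeriv_comm (v w : E) (f : smoothSubmodule E) :
    dirDeriv v (dirDeriv w f) = dirDeriv w (dirDeriv v f) := by
  ext p
  have hd : DifferentiableAt ℝ (fderiv ℝ f.1) p :=
    (((contDiff_coe f).fderiv_right (m := (⊤ : ℕ∞)) (by simp)).differentiable (by simp)) p
  have hs : IsSymmSndFDerivAt ℝ f.1 p := (contDiff_coe f).contDiffAt.isSymmSndFDerivAt
    (by
      rw [minSmoothness_of_isRCLikeNormedField]
      exact WithTop.coe_le_coe.2 (le_top : (2 : ℕ∞) ≤ ⊤))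
  have key (v w : E) : (dirDeriv v (dirDeriv w f)).1 p = fderiv ℝ (fderiv ℝ f.1) p v w := by
    rw [dirDeriv_apply]
    change fderiv ℝ (fun q => fderiv ℝ f.1 q w) p v = _
    rw [fderiv_clm_apply hd (differentiableAt_const w)]
    simp
  rw [key, key, hs.eq]

variable [FiniteDimensional ℝ E]

/-- The primitive, vanishing where `x` does, along the direction `b` of the coordinate `x`. -/
noncomputable def primitive (x : E →L[ℝ] ℝ) (b : E) :
    smoothSubmodule E →ₗ[ℝ] smoothSubmodule E where
  toFun f := ⟨fun p => x p * ∫ s in (0 : ℝ)..1, f.1 (p + ((s - 1) * x p) • b), by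
    change ContDiff ℝ (⊤ : ℕ∞) fun p => x p * ∫ s in (0 : ℝ)..1, f.1 (p + ((s - 1) * x p) • b)
    refine x.contDiff.mul (contDiff_integral_of_contDiff
      (g := fun q : E × ℝ => f.1 (q.1 + ((q.2 - 1) * x q.1) • b)) ?_ 0 1)
    exact (contDiff_coe f).comp (by fun_prop)⟩
  map_add' f g := by
    ext p
    have h (f : smoothSubmodule E) : IntervalIntegrable
        (fun s : ℝ => f.1 (p + ((s - 1) * x p) • b)) MeasureTheory.volume 0 1 :=
      ((contDiff_coe f).continuous.comp (by fun_prop)).intervalIntegrable _ _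
    simp [intervalIntegral.integral_add (h f) (h g), mul_add]
  map_smul' c f := by
    ext p
    simp [mul_left_comm]

lemma primitive_apply (x : E →L[ℝ] ℝ) (b : E) (f : smoothSubmodule E) (p : E) :
    (primitive x b f).1 p = x p * ∫ s in (0 : ℝ)..1, f.1 (p + ((s - 1) * x p) • b) := rfl

lemma dirDeriv_primitive_apply (x : E →L[ℝ] ℝ) (b v : E) (f : smoothSubmodule E) (p : E) :
    (dirDeriv v (primitive x b f)).1 p =
      x v * (∫ s in (0 : ℝ)..1, f.1 (p + ((s - 1) * x p) • b)) +
      x p * ∫ s in (0 : ℝ)..1, fderiv ℝ f.1 (p + ((s - 1) * x p) • b)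
        (v + ((s - 1) * x v) • b) := by
  set g : E × ℝ → ℝ := fun q => f.1 (q.1 + ((q.2 - 1) * x q.1) • b) with hgdef
  have hg : ContDiff ℝ (⊤ : ℕ∞) g := (contDiff_coe f).comp (by fun_prop)
  have hg₁ : ContDiff ℝ 1 g := hg.of_le (by simp)
  have hI := hasFDerivAt_integral_of_contDiff hg₁ 0 1 p
  have hint : IntervalIntegrable
      (fun s : ℝ => (fderiv ℝ g (p, s)).comp (ContinuousLinearMap.inl ℝ E ℝ))
      MeasureTheory.volume 0 1 :=
    (((hg₁.continuous_fderiv one_ne_zero).clm_comp continuous_const).comp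
      (by fun_prop : Continuous fun s : ℝ => (p, s))).intervalIntegrable _ _
  have hg' (s : ℝ) : fderiv ℝ g (p, s) (v, 0) =
      fderiv ℝ f.1 (p + ((s - 1) * x p) • b) (v + ((s - 1) * x v) • b) := by
    have hin : HasFDerivAt (fun q : E => q + ((s - 1) * x q) • b)
        (ContinuousLinearMap.id ℝ E + ((s - 1) • x).smulRight b) p :=
      (hasFDerivAt_id p).add (((s - 1) • x).hasFDerivAt.smul_const b)
    have h₁ := (differentiableAt_coe f (p + ((s - 1) * x p) • b)).hasFDerivAt.comp p hin
    have h₂ := ((hg₁.differentiable one_ne_zero) (p, s)).hasFDerivAt.comp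
      (f := fun q : E => (q, s)) p (hasFDerivAt_prodMk_left p s)
    simpa using congrArg (fun T => T v) (h₂.unique h₁)
  have hmul := (x.hasFDerivAt (x := p)).fun_mul hI
  rw [dirDeriv_apply]
  have : (primitive x b f).1 = fun p => x p * ∫ s in (0 : ℝ)..1, g (p, s) := rfl
  rw [this, hmul.fderiv]
  change x p * (∫ s in (0 : ℝ)..1, (fderiv ℝ g (p, s)).comp (ContinuousLinearMap.inl ℝ E ℝ)) v +
    (∫ s in (0 : ℝ)..1, g (p, s)) * x v = _
  rw [ContinuousLinearMap.intervalIntegral_apply hint]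
  simp only [ContinuousLinearMap.comp_apply, ContinuousLinearMap.inl_apply, hg']
  ring

lemma dirDeriv_primitive_self {x : E →L[ℝ] ℝ} {b : E} (hb : x b = 1) (f : smoothSubmodule E) :
    dirDeriv b (primitive x b f) = f := by
  ext p
  rw [dirDeriv_primitive_apply, hb, one_mul]
  set φ : ℝ → E := fun s => p + ((s - 1) * x p) • b with hφ
  have hφc : Continuous φ := by fun_prop
  have hφd (s : ℝ) : HasDerivAt φ (x p • b) s := by
    exact (((((hasDerivAt_id s).sub_const 1).mul_const (x p)).smul_const b).const_add p
      ).congr_deriv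
        (by simp)
  have hd (s : ℝ) : HasDerivAt (fun s => s * f.1 (φ s))
      (f.1 (φ s) + x p * (s * fderiv ℝ f.1 (φ s) b)) s := by
    have h := (hasDerivAt_id s).mul
      ((differentiableAt_coe f (φ s)).hasFDerivAt.comp_hasDerivAt s (hφd s))
    refine h.congr_deriv ?_
    simp
    ring
  have hc₁ : Continuous fun s => f.1 (φ s) := (contDiff_coe f).continuous.comp hφc
  have hc₂ : Continuous fun s => s * fderiv ℝ f.1 (φ s) b :=
    continuous_id.mul ((contDiff_coe (dirDeriv b f)).continuous.comp hφc)
  have hc₃ : Continuous fun s => x p * (s * fderiv ℝ f.1 (φ s) b) := continuous_const.mul hc₂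
  have hftc := intervalIntegral.integral_eq_sub_of_hasDerivAt (a := 0) (b := 1)
    (fun s _ => hd s) ((hc₁.add hc₃).intervalIntegrable _ _)
  rw [intervalIntegral.integral_add (hc₁.intervalIntegrable _ _)
    (hc₃.intervalIntegrable _ _),
    intervalIntegral.integral_const_mul] at hftc
  have hb' (s : ℝ) : b + ((s - 1) * 1) • b = s • b := by module
  simp only [hb', map_smul, smul_eq_mul]
  simpa [hφ] using hftc

lemma dirDeriv_primitive_of_eq_zero {x : E →L[ℝ] ℝ} {b v : E} (hv : x v = 0)
    (f : smoothSubmodule E) : dirDeriv v (primitive x b f) = primitive x b (dirDeriv v f) := by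
  ext p
  rw [dirDeriv_primitive_apply]
  simp [primitive_apply, hv, dirDeriv_apply]

end Primitive

section FirstOrder

variable {n N : ℕ}

/-- The unit vector of `J n N` in the direction of the variable `ψᴬ_μ`, for `e = (A, μ)`. -/
def jetBasis (e : Fin N × Fin n) : J n N := (0, 0, Pi.single e.1 (Pi.single e.2 (1 : ℝ)))

/-- The variable `ψᴬ_μ` as a linear functional, for `e = (A, μ)`. -/
noncomputable def jetCoord (e : Fin N × Fin n) : J n N →L[ℝ] ℝ :=
  (ContinuousLinearMap.proj (R := ℝ) (φ := fun _ : Fin n => ℝ) e.2).comp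
    ((ContinuousLinearMap.proj (R := ℝ) (φ := fun _ : Fin N => Fin n → ℝ) e.1).comp
      ((ContinuousLinearMap.snd ℝ _ _).comp (ContinuousLinearMap.snd ℝ _ _)))

lemma jetCoord_jetBasis (e f : Fin N × Fin n) :
    jetCoord f (jetBasis e) = if e = f then 1 else 0 := by
  obtain ⟨A, μ⟩ := e
  obtain ⟨B, ν⟩ := f
  change (Pi.single A (Pi.single μ (1 : ℝ)) : Fin N → Fin n → ℝ) B ν = _
  by_cases h : A = B
  · subst h
    simp [Pi.single_apply, eq_comm]
  · simp [h]

/-- Partial derivatives and primitives of first-order functions in the variables `ψᴬ_μ`. -/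
noncomputable def jetSystem (n N : ℕ) :
    PartialSystem (Fin N × Fin n) (smoothSubmodule (J n N)) where
  d e := dirDeriv (jetBasis e)
  S e := primitive (jetCoord e) (jetBasis e)
  d_comm _ _ := dirDeriv_comm _ _
  d_S_self e := dirDeriv_primitive_self (by simp [jetCoord_jetBasis])
  d_S_of_ne e f a h := dirDeriv_primitive_of_eq_zero (by simp [jetCoord_jetBasis, h]) a

end FirstOrder

theorem corollary_Cn (n N : ℕ) (hn : 0 < n) (hN : 0 < N)
    (t : Fin n → Fin n → Fin N → Fin N → J n N → ℝ)
    (htsmooth : ∀ μ ν A B, ContDiff ℝ (⊤ : ℕ∞) (t μ ν A B))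
    (heq1 : ∀ μ ν A B, t μ ν A B = t ν μ A B)
    (heq2 : ∀ μ ν A B, t μ ν A B = t μ ν B A)
    (heq4 : ∀ (μ ν ρ : Fin n) (A B C : Fin N) (p : J n N),
      pd C ρ (t μ ν A B) p + pd B ρ (t μ ν A C) p =
      pd A μ (t ρ ν B C) p + pd A ν (t ρ μ B C) p)
    (heq7 : ∀ (μ ν ρ σ : Fin n) (A B C D : Fin N) (p : J n N),
      pd B μ (pd C ν (t ρ σ A D)) p + pd B ν (pd C μ (t ρ σ A D)) p =
      pd A ρ (pd D σ (t μ ν B C)) p + pd A σ (pd D ρ (t μ ν B C)) p) :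
    ∃ L : J n N → ℝ, ContDiff ℝ (⊤ : ℕ∞) L ∧
      ∀ (μ ν : Fin n) (A B : Fin N) (p : J n N),
        t μ ν A B p = -(1/2) * (pd A μ (pd B ν L) p + pd A ν (pd B μ L) p) := by
  have hcompat : (jetSystem n N).Compatible fun μ ν A B => ⟨t μ ν A B, htsmooth μ ν A B⟩ :=
    { symm_col := fun μ ν A B => Subtype.ext (heq1 μ ν A B)
      symm_row := fun μ ν A B => Subtype.ext (heq2 μ ν A B)
      first := fun μ ν ρ A B C => Subtype.ext (funext (heq4 μ ν ρ A B C))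
      second := fun μ ν ρ σ A B C D => Subtype.ext (funext (heq7 μ ν ρ σ A B C D)) }
  obtain ⟨L, hL⟩ := hcompat.exists_perm_eq
  refine ⟨((-2 : ℝ) • L).1, contDiff_coe _, fun μ ν A B p => ?_⟩
  have h : (⟨t μ ν A B, htsmooth μ ν A B⟩ : smoothSubmodule (J n N)) =
      (-(1 / 2) : ℝ) • (jetSystem n N).perm ((-2 : ℝ) • L) μ ν A B := by
    rw [congrFun (congrFun (congrFun (congrFun hL μ) ν) A) B]
    simp only [PartialSystem.perm, map_smul]
    module
  exact congrArg (fun f => f.1 p) h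
end
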